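/- Let K be a number field and x ≥ 3. Let T_F be the positive root of T² − 7.0604·T − 10.1186 = 0, let L := √5 + log δ_K, let S := (√5−1)π√x/(2n_K) + 21.3270 + 33.3542/n_K, let T_0 be the unique real number T > T_F satisfying (T − 7.0604 − 10.1186/T)·(log(T/(2π)) + L) = S, and let w := log(T_0/(2π)) + L. Then (18.7781 + 27.5673/n_K − 5.0593·w)/T_0² ≤ 0.5167·π/(n_K·√x). -/

import Mathlib

open Filter Topology NumberField

noncomputable section

/-- `n_K`, the degree of `K` over `ℚ`, as a real number. -/
def nK (K : Type*) [Field K] [NumberField K] : ℝ := (Module.finrank ℚ K : ℝ)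

/-- `Δ_K`, the absolute value of the discriminant of `K`, as a real number. -/
def DeltaK (K : Type*) [Field K] [NumberField K] : ℝ := |(NumberField.discr K : ℝ)|

/-- `δ_K := Δ_K^{1/n_K}`, the root discriminant of `K`. -/
def deltaK (K : Type*) [Field K] [NumberField K] : ℝ := DeltaK K ^ (1 / nK K)

/-- `d_K := r_1 + r_2 - 1`. -/
def dK (K : Type*) [Field K] [NumberField K] : ℝ :=
  (NumberField.InfinitePlace.nrRealPlaces K : ℝ)
    + (NumberField.InfinitePlace.nrComplexPlaces K : ℝ) - 1

/-- Two-dimensional Hermite reduction. -/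
theorem hermite_two {H : Type*} [NormedAddCommGroup H] [InnerProductSpace ℝ H]
    (Λ : AddSubgroup H) (D : ℝ) (hD : 0 < D)
    (h : ∃ u ∈ Λ, ∃ v ∈ Λ, inner ℝ u u * inner ℝ v v - inner ℝ u v ^ 2 = D) :
    ∃ u ∈ Λ, ∃ v ∈ Λ, inner ℝ u u * inner ℝ v v - inner ℝ u v ^ 2 = D ∧
      (inner ℝ u u) ^ 2 ≤ 1.336 * D := by
  let S : Set ℝ := {A | ∃ u ∈ Λ, ∃ v ∈ Λ,
    inner ℝ u u * inner ℝ v v - inner ℝ u v ^ 2 = D ∧ A = inner ℝ u u}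
  have hne : S.Nonempty := by
    obtain ⟨u, hu, v, hv, huv⟩ := h
    exact ⟨_, u, hu, v, hv, huv, rfl⟩
  have hpos : ∀ A ∈ S, 0 < A := by
    rintro A ⟨u, hu, v, hv, huv, rfl⟩
    rcases (real_inner_self_nonneg (x := u)).lt_or_eq with h0 | h0
    · exact h0
    · rw [← h0] at huv
      nlinarith [sq_nonneg (inner ℝ u v)]
  have hbd : BddBelow S := ⟨0, fun A hA => (hpos A hA).le⟩
  -- find near minimal element
  have hnear : ∃ A ∈ S, (∀ C ∈ S, A ≤ 1.001 * C) ∨ A ^ 2 ≤ 1.336 * D := by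
    by_cases hI : 0 < sInf S
    · obtain ⟨A, hA, hA'⟩ := exists_lt_of_csInf_lt hne
        (show sInf S < 1.001 * sInf S by linarith)
      refine ⟨A, hA, Or.inl fun C hC => ?_⟩
      have := csInf_le hbd hC
      linarith
    · have hsq : 0 < Real.sqrt D := Real.sqrt_pos.mpr hD
      obtain ⟨A, hA, hA'⟩ := exists_lt_of_csInf_lt hne
        (show sInf S < Real.sqrt D by linarith)
      refine ⟨A, hA, Or.inr ?_⟩
      have h1 := hpos A hA
      have h2 := Real.sq_sqrt hD.le
      nlinarith
  obtain ⟨A, hA, hmin⟩ := hnear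
  have hA0 := hpos A hA
  obtain ⟨u, hu, v, hv, huv, rfl⟩ := hA
  rcases hmin with hmin | hmin
  swap
  · exact ⟨u, hu, v, hv, huv, hmin⟩
  set A := inner ℝ u u with hAdef
  set B := inner ℝ u v with hBdef
  let k : ℤ := round (B / A)
  have hk : |B / A - k| ≤ 1 / 2 := abs_sub_round _
  let v' := v - k • u
  have hv' : v' ∈ Λ := Λ.sub_mem hv (Λ.zsmul_mem hu k)
  have hv'e : v' = v - (k : ℝ) • u := by simp [v', Int.cast_smul_eq_zsmul]
  have e1 : inner ℝ u v' = B - k * A := by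
    rw [hv'e, inner_sub_right, inner_smul_right]
  have e2 : inner ℝ v' v' = inner ℝ v v - 2 * k * B + k ^ 2 * A := by
    rw [hv'e, inner_sub_right, inner_sub_left, inner_sub_left, inner_smul_right, inner_smul_right,
      inner_smul_left, inner_smul_left, real_inner_comm u v]
    simp only [conj_trivial, ← hAdef, ← hBdef]
    ring
  have hg : A * inner ℝ v' v' - inner ℝ u v' ^ 2 = D := by
    rw [e1, e2, ← huv]; ring
  have hC : inner ℝ v' v' ∈ S := by
    refine ⟨v', hv', u, hu, ?_, rfl⟩
    rw [real_inner_comm u v', mul_comm]; exact hg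
  have h1 := hmin _ hC
  refine ⟨u, hu, v, hv, huv, ?_⟩
  have h2 : (inner ℝ u v') ^ 2 ≤ A ^ 2 / 4 := by
    rw [e1]
    have : B - k * A = (B / A - k) * A := by field_simp
    rw [this, mul_pow, ← sq_abs (B / A - k)]
    have := abs_nonneg (B / A - k)
    have h3 : |B / A - k| ^ 2 ≤ 1 / 4 := by nlinarith
    nlinarith [sq_nonneg A]
  nlinarith

theorem hermite_three {H : Type*} [NormedAddCommGroup H] [InnerProductSpace ℝ H]
    (Λ : AddSubgroup H) (D : ℝ) (hD : 0 < D)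
    (G : H → H → H → ℝ)
    (hG : ∀ u v w, G u v w = inner ℝ u u * (inner ℝ v v * inner ℝ w w - inner ℝ v w ^ 2)
      - inner ℝ u v ^ 2 * inner ℝ w w + 2 * inner ℝ u v * inner ℝ u w * inner ℝ v w
      - inner ℝ u w ^ 2 * inner ℝ v v)
    (h : ∃ u ∈ Λ, ∃ v ∈ Λ, ∃ w ∈ Λ, G u v w = D) :
    ∃ u ∈ Λ, 0 < (inner ℝ u u : ℝ) ∧ (inner ℝ u u) ^ 3 ≤ 2.382 * D := by
  let S : Set ℝ := {A | ∃ u ∈ Λ, ∃ v ∈ Λ, ∃ w ∈ Λ, G u v w = D ∧ A = inner ℝ u u}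
  have hne : S.Nonempty := by
    obtain ⟨u, hu, v, hv, w, hw, huv⟩ := h
    exact ⟨_, u, hu, v, hv, w, hw, huv, rfl⟩
  have hpos : ∀ A ∈ S, 0 < A := by
    rintro A ⟨u, hu, v, hv, w, hw, huv, rfl⟩
    rcases (real_inner_self_nonneg (x := u)).lt_or_eq with h0 | h0
    · exact h0
    · have hu0 : u = 0 := inner_self_eq_zero.mp h0.symm
      rw [hG, hu0] at huv
      simp at huv
      linarith
  have hbd : BddBelow S := ⟨0, fun A hA => (hpos A hA).le⟩
  have hnear : ∃ A ∈ S, (∀ C ∈ S, A ≤ 1.001 * C) ∨ A ^ 3 ≤ 2.382 * D := by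
    by_cases hI : 0 < sInf S
    · obtain ⟨A, hA, hA'⟩ := exists_lt_of_csInf_lt hne
        (show sInf S < 1.001 * sInf S by linarith)
      refine ⟨A, hA, Or.inl fun C hC => ?_⟩
      have := csInf_le hbd hC
      linarith
    · obtain ⟨A, hA, hA'⟩ := exists_lt_of_csInf_lt hne
        (show sInf S < min 1 D by
          have : 0 < min 1 D := lt_min one_pos hD
          linarith)
      refine ⟨A, hA, Or.inr ?_⟩
      have h1 := hpos A hA
      have h2 := hA'.trans_le (min_le_left _ _)
      have h3 := hA'.trans_le (min_le_right _ _)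
      have : A ^ 3 ≤ A := by
        have : A ^ 3 = A * A ^ 2 := by ring
        rw [this]
        have : A ^ 2 ≤ 1 := by nlinarith
        nlinarith
      linarith
  obtain ⟨A, hA, hmin⟩ := hnear
  have hA0 := hpos A hA
  obtain ⟨u, hu, v, hv, w, hw, huv, rfl⟩ := hA
  refine ⟨u, hu, hA0, ?_⟩
  rcases hmin with hmin | hmin
  swap
  · exact hmin
  set A := inner ℝ u u with hAdef
  -- projection orthogonal to u
  let π : H →ₗ[ℝ] H := LinearMap.id - (1 / A) • ((innerₛₗ ℝ u).smulRight u)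
  have hπ : ∀ x, π x = x - (inner ℝ u x / A) • u := by
    intro x; simp [π, div_eq_inv_mul, smul_smul]
  have hin : ∀ x y, inner ℝ (π x) (π y) = inner ℝ x y - inner ℝ u x * inner ℝ u y / A := by
    intro x y
    rw [hπ, hπ, inner_sub_right, inner_sub_left, inner_sub_left, inner_smul_right, inner_smul_right,
      inner_smul_left, inner_smul_left, real_inner_comm u x]
    simp only [conj_trivial, ← hAdef]
    field_simp
    ring
  have hGram : ∀ x y, G u x y = A * (inner ℝ (π x) (π x) * inner ℝ (π y) (π y) -
      inner ℝ (π x) (π y) ^ 2) := by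
    intro x y
    rw [hG, hin, hin, hin]
    field_simp
    ring
  obtain ⟨p, ⟨v', hv', rfl⟩, q, ⟨w', hw', rfl⟩, hpq, hle⟩ := hermite_two (Λ.map π.toAddMonoidHom)
    (D / A) (by positivity) ⟨π v, ⟨v, hv, rfl⟩, π w, ⟨w, hw, rfl⟩, by
      rw [← huv, hGram]; field_simp⟩
  simp only [LinearMap.toAddMonoidHom_coe] at hpq hle
  set B := inner ℝ u v' with hBdef
  let k : ℤ := round (B / A)
  have hk : |B / A - k| ≤ 1 / 2 := abs_sub_round _
  let v1 := v' - k • u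
  have hv1 : v1 ∈ Λ := Λ.sub_mem hv' (Λ.zsmul_mem hu k)
  have hv1e : v1 = v' - (k : ℝ) • u := by simp [v1, Int.cast_smul_eq_zsmul]
  have e1 : inner ℝ u v1 = B - k * A := by
    rw [hv1e, inner_sub_right, inner_smul_right]
  have e0 : π v1 = π v' := by
    have : π u = 0 := by
      rw [hπ, ← hAdef, div_self hA0.ne', one_smul, sub_self]
    rw [hv1e, map_sub, map_smul, this, smul_zero, sub_zero]
  have hG1 : G v1 u w' = D := by
    have h1 : G v1 u w' = G u v1 w' := by
      rw [hG, hG, real_inner_comm u v1]; ring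
    rw [h1, hGram, e0, hpq]; field_simp
  have h1 := hmin _ ⟨v1, hv1, u, hu, w', hw', hG1, rfl⟩
  have h2 : (inner ℝ u v1) ^ 2 ≤ A ^ 2 / 4 := by
    rw [e1]
    have : B - k * A = (B / A - k) * A := by field_simp
    rw [this, mul_pow, ← sq_abs (B / A - k)]
    have := abs_nonneg (B / A - k)
    have h3 : |B / A - k| ^ 2 ≤ 1 / 4 := by nlinarith
    nlinarith [sq_nonneg A]
  have h3 : inner ℝ v1 v1 = inner ℝ (π v') (π v') + inner ℝ u v1 ^ 2 / A := by
    rw [← e0, hin]; ring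
  have h4 : inner ℝ u v1 ^ 2 / A ≤ A / 4 := by
    rw [div_le_iff₀ hA0]; linarith
  set Q := inner ℝ (π v') (π v')
  have h5 : 0.749 * A ≤ Q := by linarith
  have h6 : (0.749 * A) ^ 2 ≤ Q ^ 2 := pow_le_pow_left₀ (by positivity) h5 2
  have h7 : (0.749 * A) ^ 2 ≤ 1.336 * (D / A) := h6.trans hle
  have h8 : (0.749 * A) ^ 2 * A ≤ 1.336 * D := by
    calc (0.749 * A) ^ 2 * A ≤ 1.336 * (D / A) * A := by gcongr
      _ = 1.336 * D := by field_simp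
  have h9 : (0.749 * A) ^ 2 * A = 0.561001 * A ^ 3 := by ring
  linarith

theorem exists_basis_one {R A : Type*} [CommRing R] [IsDomain R] [IsPrincipalIdealRing R]
    [CommRing A] [Nontrivial A] [Algebra R A] [Module.Free R A] [Module.Finite R A]
    [FaithfulSMul R A] (n : ℕ) (hn : Module.finrank R A = n + 1)
    (ht : ∀ (r : R) (x : A), r ≠ 0 → (∃ s : R, r • x = algebraMap R A s) →
      ∃ s : R, x = algebraMap R A s) :
    ∃ b : Module.Basis (Fin (n + 1)) R A, b 0 = 1 := by
  let W : Submodule R A := Submodule.span R {(1 : A)}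
  have hW : ∀ x : A, x ∈ W ↔ ∃ s : R, x = algebraMap R A s := by
    intro x
    rw [Submodule.mem_span_singleton]
    simp [Algebra.algebraMap_eq_smul_one, eq_comm]
  have : Module.IsTorsionFree R (A ⧸ W) := by
    rw [Module.isTorsionFree_iff_smul_eq_zero]
    intro r x
    obtain ⟨x, rfl⟩ := W.mkQ_surjective x
    intro h
    by_cases hr : r = 0
    · exact Or.inl hr
    right
    rw [← map_smul] at h
    simp only [Submodule.mkQ_apply, Submodule.Quotient.mk_eq_zero, hW] at h ⊢
    exact ht r x hr h
  have : Module.Free R (A ⧸ W) := Module.free_of_finite_type_torsion_free'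
  let bQ := Module.finBasis R (A ⧸ W)
  have hli : LinearIndependent R (fun _ : Unit => (1 : A)) := by
    rw [linearIndependent_unique_iff]
    exact one_ne_zero
  let bW : Module.Basis Unit R W := (Module.Basis.span hli).map
    (LinearEquiv.ofEq _ _ (by simp [W]))
  have hbW : ((bW ()) : A) = 1 := by
    simp [bW, Module.Basis.span_apply]
  let b := bW.sumQuot bQ
  have hc : Module.finrank R (A ⧸ W) = n := by
    have h1 := Module.finrank_eq_card_basis b
    simp at h1
    omega
  let e : Unit ⊕ Fin (Module.finrank R (A ⧸ W)) ≃ Fin (n + 1) :=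
    (Equiv.sumCongr (Equiv.refl Unit) (finCongr hc)).trans ((Equiv.sumComm _ _).trans
      ((Equiv.optionEquivSumPUnit _).symm.trans (finSuccEquiv n).symm))
  refine ⟨b.reindex e, ?_⟩
  have : e.symm 0 = Sum.inl () := by
    rw [Equiv.symm_apply_eq]; simp [e]
  rw [Module.Basis.reindex_apply, this, Module.Basis.sumQuot_inl, hbW]

section
variable {K : Type*} [Field K] [NumberField K]

theorem exists_int_basis_one (n : ℕ) (hn : Module.finrank ℚ K = n + 1) :
    ∃ b : Module.Basis (Fin (n + 1)) ℤ (𝓞 K), b 0 = 1 := by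
  apply exists_basis_one n
  · rw [RingOfIntegers.rank, hn]
  · rintro r x hr ⟨s, hs⟩
    have h1 : (r : K) * (x : K) = s := by
      have := congrArg (algebraMap (𝓞 K) K) hs
      simpa using this
    have h2 : (x : K) = algebraMap ℚ K (s / r) := by
      have : (r : K) ≠ 0 := by exact_mod_cast hr
      rw [map_div₀, map_intCast, map_intCast, eq_div_iff this, mul_comm]
      exact h1
    have h3 : IsIntegral ℤ ((s / r : ℚ)) := by
      have h4 := x.isIntegral_coe
      change IsIntegral ℤ (x : K) at h4
      rw [h2] at h4
      exact (isIntegral_algebraMap_iff (algebraMap ℚ K).injective).mp h4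
    obtain ⟨m, hm⟩ := IsIntegrallyClosed.isIntegral_iff.mp h3
    refine ⟨m, ?_⟩
    apply RingOfIntegers.ext
    rw [h2, ← hm]
    simp

/-- Minkowski-type embedding into Euclidean space. -/
noncomputable def phi {n : ℕ} (e : Fin n ≃ (K →ₐ[ℚ] ℂ)) : 𝓞 K →+ EuclideanSpace ℂ (Fin n) where
  toFun x := WithLp.toLp 2 fun i => e i (x : K)
  map_zero' := by ext; simp
  map_add' x y := by ext; simp

@[simp] theorem phi_apply {n : ℕ} (e : Fin n ≃ (K →ₐ[ℚ] ℂ)) (x : 𝓞 K) (i : Fin n) :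
    phi e x i = e i (x : K) := rfl

theorem sum_conj_real {n : ℕ} (e : Fin n ≃ (K →ₐ[ℚ] ℂ)) (x y : K) :
    (starRingEnd ℂ) (∑ i, (starRingEnd ℂ) (e i x) * e i y) =
      ∑ i, (starRingEnd ℂ) (e i x) * e i y := by
  let c : (K →ₐ[ℚ] ℂ) ≃ (K →ₐ[ℚ] ℂ) :=
    (AlgEquiv.refl (R := ℚ) (A₁ := K)).arrowCongr (Complex.conjAe.restrictScalars ℚ)
  have hc : ∀ σ x, c σ x = (starRingEnd ℂ) (σ x) := by
    intro σ x; simp [c, AlgEquiv.arrowCongr]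
  rw [map_sum]
  refine Fintype.sum_equiv (e.trans (c.trans e.symm)) _ _ ?_
  intro i
  simp [hc]

theorem inner_phi {n : ℕ} (e : Fin n ≃ (K →ₐ[ℚ] ℂ)) (x y : 𝓞 K) :
    ((inner ℝ (phi e x) (phi e y) : ℝ) : ℂ) = ∑ i, (starRingEnd ℂ) (e i x) * e i y := by
  rw [PiLp.inner_apply]
  simp only [phi_apply, Complex.inner]
  have := Complex.conj_eq_iff_re.mp (sum_conj_real e (x : K) (y : K))
  rw [← this, Complex.re_sum]
  congr 1
  exact Finset.sum_congr rfl fun i _ => by rw [mul_comm]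

theorem discr_det {n : ℕ} (e : Fin n ≃ (K →ₐ[ℚ] ℂ)) (b : Module.Basis (Fin n) ℤ (𝓞 K)) :
    ((discr K : ℤ) : ℂ) = (Matrix.of fun i j => e j (b i)).det ^ 2 := by
  have h3 : ((discr K : ℤ) : ℚ) = Algebra.discr ℚ (fun i => ((b i : 𝓞 K) : K)) := by
    rw [← discr_eq_discr K b]
    have := Algebra.discr_localizationLocalization ℤ (nonZeroDivisors ℤ) (Rₘ := ℚ) K b
    rw [eq_intCast] at this
    rw [← this]
    congr 1
    ext i
    simp
  have h4 := Algebra.discr_eq_det_embeddingsMatrixReindex_pow_two ℚ ℂ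
    (fun i => ((b i : 𝓞 K) : K)) e
  rw [← h3] at h4
  rw [map_intCast] at h4
  exact h4

theorem det_gram {n : ℕ} (e : Fin n ≃ (K →ₐ[ℚ] ℂ)) (b : Module.Basis (Fin n) ℤ (𝓞 K)) :
    (Matrix.of fun i j => (inner ℝ (phi e (b i)) (phi e (b j)) : ℝ)).det = |(discr K : ℝ)| := by
  let M : Matrix (Fin n) (Fin n) ℂ := Matrix.of fun i j => e j (b i)
  have h1 : ((Matrix.of fun i j => (inner ℝ (phi e (b i)) (phi e (b j)) : ℝ)).map
      (algebraMap ℝ ℂ)) = (M.map (starRingEnd ℂ)) * M.transpose := by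
    ext i j
    simp only [Matrix.map_apply, Matrix.of_apply, Matrix.mul_apply, Matrix.transpose_apply, M]
    exact inner_phi e _ _
  have h2 : ((discr K : ℤ) : ℂ) = M.det ^ 2 := discr_det e b
  have h5 := congrArg Matrix.det h1
  rw [Matrix.det_mul, Matrix.det_transpose, ← RingHom.mapMatrix_apply, ← RingHom.mapMatrix_apply,
    ← RingHom.map_det, ← RingHom.map_det] at h5
  have h6 : ‖((discr K : ℤ) : ℂ)‖ = ‖M.det‖ ^ 2 := by rw [h2, norm_pow]
  have h7 : (starRingEnd ℂ) M.det * M.det = ((‖M.det‖ ^ 2 : ℝ) : ℂ) := by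
    rw [mul_comm, Complex.mul_conj, Complex.normSq_eq_norm_sq]
  rw [h7] at h5
  have h8 := Complex.ofReal_injective h5
  rw [Algebra.algebraMap_self, RingHom.id_apply] at h8
  rw [h8, ← h6]
  simp
end

section
variable {K : Type*} [Field K] [NumberField K]

theorem vdm_discr {n : ℕ} (e : Fin n ≃ (K →ₐ[ℚ] ℂ)) (b : Module.Basis (Fin n) ℤ (𝓞 K))
    (α : 𝓞 K) : ∃ k : ℤ, (Matrix.vandermonde fun i => e i (α : K)).det ^ 2 =
      ((k ^ 2 * discr K : ℤ) : ℂ) := by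
  let P : Matrix (Fin n) (Fin n) ℤ := Matrix.of fun i j => b.repr (α ^ (i : ℕ)) j
  refine ⟨P.det, ?_⟩
  have h : (Matrix.vandermonde fun i => e i (α : K)).transpose =
      P.map (Int.castRingHom ℂ) * (Matrix.of fun i j => e j (b i)) := by
    ext i j
    simp only [Matrix.transpose_apply, Matrix.vandermonde_apply, Matrix.mul_apply,
      Matrix.map_apply, Matrix.of_apply, P]
    have h1 := b.sum_repr (α ^ (i : ℕ))
    have h2 := congrArg (fun y : 𝓞 K => e j (y : K)) h1
    simp only [map_sum, map_pow, zsmul_eq_mul, map_mul, map_intCast] at h2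
    rw [← h2]
    rfl
  have h3 := congrArg Matrix.det h
  rw [Matrix.det_transpose, Matrix.det_mul, ← RingHom.mapMatrix_apply, ← RingHom.map_det] at h3
  rw [h3, mul_pow, ← discr_det e b]
  simp

theorem trace_emb {n : ℕ} (e : Fin n ≃ (K →ₐ[ℚ] ℂ)) (α : 𝓞 K) :
    ∑ i, e i (α : K) = ((Algebra.trace ℤ (𝓞 K) α : ℤ) : ℂ) := by
  have h := trace_eq_sum_embeddings ℂ (K := ℚ) (L := K) (x := (α : K))
  rw [Equiv.sum_comp e (fun σ : K →ₐ[ℚ] ℂ => σ (α : K)), ← h]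
  rw [← Algebra.coe_trace_int]
  simp

theorem norm_emb {n : ℕ} (e : Fin n ≃ (K →ₐ[ℚ] ℂ)) (α : 𝓞 K) :
    ∏ i, e i (α : K) = ((Algebra.norm ℤ α : ℤ) : ℂ) := by
  have h := Algebra.norm_eq_prod_embeddings ℚ ℂ (α : K)
  rw [Equiv.prod_comp e (fun σ : K →ₐ[ℚ] ℂ => σ (α : K)), ← h]
  rw [← Algebra.coe_norm_int]
  simp

/-- Projection orthogonal to one. -/
noncomputable def psi {n : ℕ} (e : Fin n ≃ (K →ₐ[ℚ] ℂ)) : 𝓞 K →+ EuclideanSpace ℂ (Fin n) where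
  toFun x := phi e x - ((Algebra.trace ℤ (𝓞 K) x : ℝ) / n) • phi e 1
  map_zero' := by simp
  map_add' x y := by
    simp only [map_add, Int.cast_add, add_div, add_smul]; abel

theorem inner_one {n : ℕ} (e : Fin n ≃ (K →ₐ[ℚ] ℂ)) (x : 𝓞 K) :
    (inner ℝ (phi e 1) (phi e x) : ℝ) = Algebra.trace ℤ (𝓞 K) x := by
  have h := inner_phi e 1 x
  simp only [map_one, one_mul, trace_emb] at h
  exact_mod_cast h

theorem trace_one' {n : ℕ} (e : Fin n ≃ (K →ₐ[ℚ] ℂ)) :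
    Algebra.trace ℤ (𝓞 K) 1 = n := by
  have h := trace_emb e 1
  simp at h
  exact_mod_cast h.symm

theorem inner_psi {n : ℕ} (hn : n ≠ 0) (e : Fin n ≃ (K →ₐ[ℚ] ℂ)) (x y : 𝓞 K) :
    (inner ℝ (psi e x) (psi e y) : ℝ) = inner ℝ (phi e x) (phi e y) -
      (Algebra.trace ℤ (𝓞 K) x : ℝ) * (Algebra.trace ℤ (𝓞 K) y : ℝ) / n := by
  have hn' : (n : ℝ) ≠ 0 := by exact_mod_cast hn
  have h1 := inner_one e x
  rw [real_inner_comm] at h1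
  have h2 := inner_one e y
  have h3 := inner_one e 1
  rw [trace_one' e] at h3
  simp only [psi, AddMonoidHom.coe_mk, ZeroHom.coe_mk, inner_sub_left, inner_sub_right,
    real_inner_smul_left, real_inner_smul_right, h1, h2, h3]
  push_cast
  field_simp
  ring

theorem psi_int {n : ℕ} (hn : n ≠ 0) (e : Fin n ≃ (K →ₐ[ℚ] ℂ)) (m : ℤ) : psi e (m : 𝓞 K) = 0 := by
  have h : psi e 1 = 0 := by
    have hn' : (n : ℝ) ≠ 0 := by exact_mod_cast hn
    simp [psi, trace_one' e, hn']
  have := map_zsmul (psi e) m 1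
  rw [h] at this
  simpa using this

theorem sq_norm_emb {n : ℕ} (hn : n ≠ 0) (e : Fin n ≃ (K →ₐ[ℚ] ℂ)) (x : 𝓞 K) :
    ∑ i, ‖e i (x : K)‖ ^ 2 = inner ℝ (psi e x) (psi e x) +
      (Algebra.trace ℤ (𝓞 K) x : ℝ) ^ 2 / n := by
  rw [inner_psi hn, ← sq, sub_add_cancel, real_inner_self_eq_norm_sq, EuclideanSpace.norm_sq_eq]
  rfl

theorem shift_trace {n : ℕ} (hn : n ≠ 0) (e : Fin n ≃ (K →ₐ[ℚ] ℂ)) (x : 𝓞 K) :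
    ∃ y : 𝓞 K, (inner ℝ (psi e y) (psi e y) : ℝ) = inner ℝ (psi e x) (psi e x) ∧
      0 ≤ Algebra.trace ℤ (𝓞 K) y ∧ 2 * Algebra.trace ℤ (𝓞 K) y ≤ n := by
  set t := Algebra.trace ℤ (𝓞 K) x with ht
  have htm : ∀ m : ℤ, Algebra.trace ℤ (𝓞 K) (m : 𝓞 K) = n * m := by
    intro m
    have := map_zsmul (Algebra.trace ℤ (𝓞 K)) m 1
    rw [trace_one' e] at this
    rw [zsmul_eq_mul, mul_one] at this
    rw [this, zsmul_eq_mul, mul_comm]; simp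
  have hn' : (0 : ℤ) < n := by positivity
  have h1 := Int.emod_nonneg t hn'.ne'
  have h2 := Int.emod_lt_of_pos t hn'
  have h3 := Int.emod_add_mul_ediv t n
  by_cases h : 2 * (t % n) ≤ n
  · refine ⟨x - ((t / n : ℤ) : 𝓞 K), ?_, ?_, ?_⟩
    · rw [map_sub, psi_int hn, sub_zero]
    · rw [map_sub, htm]; linarith
    · rw [map_sub, htm]; linarith
  · refine ⟨((t / n + 1 : ℤ) : 𝓞 K) - x, ?_, ?_, ?_⟩
    · rw [map_sub, psi_int hn, zero_sub, inner_neg_neg]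
    · rw [map_sub, htm]; linarith
    · rw [map_sub, htm]; linarith
end

theorem norm_triple_bound (a b c : ℝ) (ha : 0 ≤ a) (hb : 0 ≤ b) (hc : 0 ≤ c) (h : a + b + c ≤ 3.465) :
    a * b * c ≤ 1.6 := by
  have h1 : 27 * (a * b * c) ≤ (a + b + c) ^ 3 := by
    nlinarith [mul_nonneg ha (sq_nonneg (b - c)), mul_nonneg hb (sq_nonneg (a - c)),
      mul_nonneg hc (sq_nonneg (a - b)), mul_nonneg ha (sq_nonneg (a - b)),
      mul_nonneg ha (sq_nonneg (a - c)), mul_nonneg hb (sq_nonneg (b - a)),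
      mul_nonneg hb (sq_nonneg (b - c)), mul_nonneg hc (sq_nonneg (c - a)),
      mul_nonneg hc (sq_nonneg (c - b))]
  have h2 : (a + b + c) ^ 3 ≤ 3.465 ^ 3 := by gcongr
  norm_num at h2
  linarith

theorem sq_mul_cases (k D : ℤ) (hD : (13 ≤ D ∨ D ≤ -13) ∧ D ≤ 22 ∧ -22 ≤ D) :
    k ^ 2 * D = 0 ∨ k ^ 2 * D = D ∨ k ^ 2 * D = 4 * D ∨ 117 ≤ k ^ 2 * D ∨ k ^ 2 * D ≤ -117 := by
  by_cases h : |k| ≤ 2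
  · rw [abs_le] at h
    obtain ⟨h1, h2⟩ := h
    interval_cases k <;> simp
  · have h9 : 9 ≤ k ^ 2 := by
      have : 3 ≤ |k| := by omega
      rw [← sq_abs]; nlinarith
    rcases hD.1 with h | h
    · right; right; right; left; nlinarith
    · right; right; right; right; nlinarith

section
variable {K : Type*} [Field K] [NumberField K]

theorem exists_emb_equiv (n : ℕ) (hn : Module.finrank ℚ K = n) :
    Nonempty (Fin n ≃ (K →ₐ[ℚ] ℂ)) := by
  have : Fintype.card (K →ₐ[ℚ] ℂ) = n := by rw [AlgHom.card, hn]
  exact ⟨(Fintype.equivFinOfCardEq this).symm⟩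

theorem cubic_min (hn : Module.finrank ℚ K = 3) : 13 ≤ |discr K| := by
  have h := abs_discr_ge' K
  have h1 := InfinitePlace.card_add_two_mul_card_eq_rank K
  rw [hn] at h h1
  have h2 : InfinitePlace.nrComplexPlaces K ≤ 1 := by omega
  have hpi := Real.pi_gt_d2
  have h3 : (4 / Real.pi) ^ (2 * InfinitePlace.nrComplexPlaces K) ≤ (4 / Real.pi) ^ 2 := by
    apply pow_le_pow_right₀
    · rw [le_div_iff₀ Real.pi_pos]; linarith [Real.pi_lt_four]
    · omega
  have h5 : (4 / Real.pi) ^ 2 ≤ (4 / 3.14) ^ 2 := by gcongr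
  have h4 : (12.4 : ℝ) ≤ (|discr K| : ℤ) := by
    refine le_trans ?_ h
    rw [le_div_iff₀ (by positivity)]
    have : (Nat.factorial 3 : ℝ) = 6 := by norm_num [Nat.factorial]
    rw [this]
    norm_num at h5 ⊢
    nlinarith
  by_contra hc
  have : |discr K| ≤ 12 := by omega
  have : ((|discr K| : ℤ) : ℝ) ≤ 12 := by exact_mod_cast this
  linarith

theorem cubic_short (hn : Module.finrank ℚ K = 3) (e : Fin 3 ≃ (K →ₐ[ℚ] ℂ)) (hD : |discr K| ≤ 22) :
    ∃ α : 𝓞 K, 0 < (inner ℝ (psi e α) (psi e α) : ℝ) ∧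
      (inner ℝ (psi e α) (psi e α) : ℝ) ≤ 3.1304 := by
  obtain ⟨b, hb⟩ := exists_int_basis_one (K := K) 2 hn
  have hg := det_gram e b
  have h13 := cubic_min hn
  have hD0 : (0 : ℝ) < |(discr K : ℝ)| := by
    have : (13 : ℝ) ≤ |(discr K : ℝ)| := by exact_mod_cast h13
    linarith
  have hD1 : |(discr K : ℝ)| ≤ 22 := by exact_mod_cast hD
  have h00 := inner_one e 1
  rw [trace_one' e] at h00
  obtain ⟨u, ⟨α, rfl⟩, v, -, huv, hu⟩ := hermite_two (psi e).range (|(discr K : ℝ)| / 3) (by positivity)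
    ⟨psi e (b 1), ⟨_, rfl⟩, psi e (b 2), ⟨_, rfl⟩, by
      rw [← hg, Matrix.det_fin_three]
      simp only [Matrix.of_apply, hb, inner_psi (n := 3) (by norm_num)]
      have h1 := inner_one e (b 1)
      have h2 := inner_one e (b 2)
      have h1' := h1
      have h2' := h2
      rw [real_inner_comm] at h1' h2'
      have h12 := real_inner_comm (phi e (b 1)) (phi e (b 2))
      rw [h1, h2, h1', h2', h00, ← h12]
      push_cast
      ring⟩
  refine ⟨α, ?_, ?_⟩
  · rcases (real_inner_self_nonneg (x := psi e α)).lt_or_eq with h0 | h0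
    · exact h0
    · exfalso
      rw [← h0] at huv
      nlinarith [sq_nonneg (inner ℝ (psi e α) v : ℝ)]
  · by_contra! hc
    nlinarith

theorem cubic_bound (hn : Module.finrank ℚ K = 3) : 23 ≤ |discr K| := by
  by_contra! hD
  have hD : |discr K| ≤ 22 := by omega
  have h13 := cubic_min hn
  obtain ⟨e⟩ := exists_emb_equiv (K := K) 3 hn
  obtain ⟨α₀, h0, hQ⟩ := cubic_short hn e hD
  obtain ⟨α, hα, ht0, ht1⟩ := shift_trace (by norm_num) e α₀
  rw [← hα] at h0 hQ
  have hs := sq_norm_emb (by norm_num) e α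
  have htr := trace_emb e α
  have hnm := norm_emb e α
  have hnm1 := norm_emb e (1 - α)
  obtain ⟨b, -⟩ := exists_int_basis_one (K := K) 2 hn
  obtain ⟨k, hk⟩ := vdm_discr e b α
  have hN0 : ∀ m : ℤ, Algebra.norm ℤ ((m : 𝓞 K) - α) ≠ 0 := by
    intro m hm
    rw [Algebra.norm_eq_zero_iff] at hm
    rw [← sub_eq_zero.mp hm, psi_int (by norm_num)] at h0
    simp at h0
  have hN1 := hN0 1
  have hN := hN0 0
  simp only [Int.cast_zero, zero_sub, Int.cast_one] at hN hN1
  have hN' : Algebra.norm ℤ α ≠ 0 := by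
    intro h
    rw [Algebra.norm_eq_zero_iff] at h
    apply hN
    rw [h]; simp
  generalize Algebra.norm ℤ α = N at *
  generalize Algebra.norm ℤ (1 - α) = M at *
  generalize Algebra.trace ℤ (𝓞 K) α = t at *
  simp only [map_sub, map_one] at hnm1
  generalize hz0 : e 0 (α : K) = z0 at *
  generalize hz1 : e 1 (α : K) = z1 at *
  generalize hz2 : e 2 (α : K) = z2 at *
  rw [Matrix.det_vandermonde] at hk
  simp only [Fin.sum_univ_three, Fin.prod_univ_three, hz0, hz1, hz2] at hs htr hnm hnm1
  have hk' : ((z1 - z0) * (z2 - z0) * (z2 - z1)) ^ 2 = ((k ^ 2 * discr K : ℤ) : ℂ) := by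
    rw [← hk, ← hz0, ← hz1, ← hz2]
    congr 1
    simp [Fin.prod_univ_succ, Fin.prod_Ioi_succ]
  clear hk
  generalize inner ℝ (psi e α) (psi e α) = Q at *
  generalize discr K = D at *
  have ht : t = 0 ∨ t = 1 := by push_cast at ht1; omega
  obtain ⟨q, hq⟩ : ∃ q : ℤ, q = M - 1 + t + N := ⟨_, rfl⟩
  have hq' : z0 * z1 + z0 * z2 + z1 * z2 = (q : ℂ) := by
    rw [hq]; push_cast; rw [← hnm1, ← hnm, ← htr]; ring
  have hT2 : ‖z0‖ ^ 2 + ‖z1‖ ^ 2 + ‖z2‖ ^ 2 ≤ 3.1304 + (t : ℝ) / 3 := by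
    rw [hs]
    rcases ht with rfl | rfl <;> norm_num <;> linarith
  have hNb : |N| ≤ 1 := by
    have h1 := norm_triple_bound (‖z0‖ ^ 2) (‖z1‖ ^ 2) (‖z2‖ ^ 2) (by positivity) (by positivity)
      (by positivity) (by rcases ht with rfl | rfl <;> norm_num at hT2 ⊢ <;> linarith)
    have h2 : ‖z0‖ ^ 2 * ‖z1‖ ^ 2 * ‖z2‖ ^ 2 = ((N ^ 2 : ℤ) : ℝ) := by
      rw [← mul_pow, ← mul_pow, ← norm_mul, ← norm_mul, hnm]
      rw [Complex.norm_intCast]; push_cast; rw [sq_abs]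
    rw [h2] at h1
    have h3 : N ^ 2 < 2 := by
      have : ((N ^ 2 : ℤ) : ℝ) < (2 : ℤ) := by push_cast at h1 ⊢; linarith
      exact_mod_cast this
    rw [abs_le]; constructor <;> nlinarith
  have hqb : (|t ^ 2 - 2 * q| : ℤ) ≤ 3 := by
    have h1 : ((t ^ 2 - 2 * q : ℤ) : ℂ) = z0 ^ 2 + z1 ^ 2 + z2 ^ 2 := by
      push_cast; rw [← hq', ← htr]; ring
    have h2 : (|t ^ 2 - 2 * q| : ℝ) ≤ ‖z0‖ ^ 2 + ‖z1‖ ^ 2 + ‖z2‖ ^ 2 := by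
      have := Complex.norm_intCast (t ^ 2 - 2 * q)
      push_cast at this
      rw [← this, ← norm_pow, ← norm_pow, ← norm_pow]
      push_cast at h1
      rw [h1]
      exact norm_add₃_le
    have h3 : ((|t ^ 2 - 2 * q| : ℤ) : ℝ) < (4 : ℤ) := by
      push_cast
      rcases ht with rfl | rfl <;> norm_num at hT2 h2 ⊢ <;> linarith
    have := Int.cast_lt.mp h3
    omega
  have hdisc : t ^ 2 * q ^ 2 - 4 * q ^ 3 - 4 * t ^ 3 * N + 18 * t * q * N - 27 * N ^ 2 = k ^ 2 * D := by
    have : ((t ^ 2 * q ^ 2 - 4 * q ^ 3 - 4 * t ^ 3 * N + 18 * t * q * N - 27 * N ^ 2 : ℤ) : ℂ) =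
      ((k ^ 2 * D : ℤ) : ℂ) := by
      rw [← hk']; push_cast; rw [← hq', ← htr, ← hnm]; ring
    exact_mod_cast this
  rw [abs_le] at hNb hqb
  obtain ⟨hn1, hn2⟩ := hNb
  have hDD : (13 ≤ D ∨ D ≤ -13) ∧ D ≤ 22 ∧ -22 ≤ D := by
    rw [abs_le] at hD
    rw [le_abs] at h13
    omega
  clear hT2 hs hk' hq' htr hnm hnm1 h13 hD
  have hc := sq_mul_cases k D hDD
  rcases ht with rfl | rfl
  · have hq1 : -1 ≤ q := by omega
    have hq2 : q ≤ 1 := by omega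
    interval_cases q <;> interval_cases N <;> norm_num at hdisc <;> first | omega | (rw [← hdisc] at hc; norm_num at hc; omega)
  · have hq1 : -1 ≤ q := by omega
    have hq2 : q ≤ 2 := by omega
    interval_cases q <;> interval_cases N <;> norm_num at hdisc <;> first | omega | (rw [← hdisc] at hc; norm_num at hc; omega)
end

theorem four_amgm (a b c d : ℝ) (ha : 0 ≤ a) (hb : 0 ≤ b) (hc : 0 ≤ c) (hd : 0 ≤ d) :
    a * b * c * d ≤ ((a + b + c + d) / 4) ^ 4 := by
  have h1 : a * b ≤ ((a + b) / 2) ^ 2 := by nlinarith [sq_nonneg (a - b)]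
  have h2 : c * d ≤ ((c + d) / 2) ^ 2 := by nlinarith [sq_nonneg (c - d)]
  have h3 : ((a + b) / 2) * ((c + d) / 2) ≤ ((a + b + c + d) / 4) ^ 2 := by
    nlinarith [sq_nonneg (a + b - c - d)]
  calc a * b * c * d = (a * b) * (c * d) := by ring
    _ ≤ ((a + b) / 2) ^ 2 * ((c + d) / 2) ^ 2 := by gcongr
    _ = (((a + b) / 2) * ((c + d) / 2)) ^ 2 := by ring
    _ ≤ (((a + b + c + d) / 4) ^ 2) ^ 2 := by gcongr
    _ = _ := by ring

theorem four_prod_bound (z0 z1 z2 z3 : ℂ) :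
    ‖z0 * z1 * z2 * z3‖ ^ 2 ≤ ((‖z0‖ ^ 2 + ‖z1‖ ^ 2 + ‖z2‖ ^ 2 + ‖z3‖ ^ 2) / 4) ^ 4 := by
  rw [norm_mul, norm_mul, norm_mul, mul_pow, mul_pow, mul_pow]
  exact four_amgm _ _ _ _ (by positivity) (by positivity) (by positivity) (by positivity)

theorem nsq (z : ℂ) : ‖z‖ ^ 2 = z.re ^ 2 + z.im ^ 2 := by
  rw [← Complex.normSq_eq_norm_sq, Complex.normSq_apply]; ring

theorem e3_bound (u0 u1 u2 u3 : ℂ) (h : u0 + u1 + u2 + u3 = 0)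
    (hQ : ‖u0‖ ^ 2 + ‖u1‖ ^ 2 + ‖u2‖ ^ 2 + ‖u3‖ ^ 2 ≤ 3.5637) :
    ‖u0 * u1 * (u2 + u3) + u2 * u3 * (u0 + u1)‖ < 2 := by
  have h3 : u3 = - (u0 + u1 + u2) := by linear_combination h
  have h1 : u0 * u1 * (u2 + u3) + u2 * u3 * (u0 + u1) =
      (u0 + u1) * ((u0 - u1) ^ 2 - (u2 - u3) ^ 2) / 4 := by rw [h3]; ring
  have h2 : ‖u0 * u1 * (u2 + u3) + u2 * u3 * (u0 + u1)‖ ≤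
      ‖u0 + u1‖ * (‖u0 - u1‖ ^ 2 + ‖u2 - u3‖ ^ 2) / 4 := by
    rw [h1, norm_div, norm_mul, ← norm_pow, ← norm_pow]
    have : ‖(4 : ℂ)‖ = 4 := by simp
    rw [this]
    gcongr
    exact norm_sub_le _ _
  have h4 : ‖u0 + u1‖ ^ 2 * 2 + (‖u0 - u1‖ ^ 2 + ‖u2 - u3‖ ^ 2) =
      2 * (‖u0‖ ^ 2 + ‖u1‖ ^ 2 + ‖u2‖ ^ 2 + ‖u3‖ ^ 2) := by
    have a1 := parallelogram_law_with_norm ℝ u0 u1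
    have a2 := parallelogram_law_with_norm ℝ u2 u3
    have a3 : ‖u2 + u3‖ = ‖u0 + u1‖ := by
      rw [← norm_neg (u0 + u1)]; congr 1; linear_combination h
    rw [a3] at a2
    nlinarith
  have h0 := norm_nonneg (u0 + u1)
  set a := ‖u0 + u1‖
  set m := ‖u0 - u1‖ ^ 2 + ‖u2 - u3‖ ^ 2
  have hm : m ≤ 7.1274 - 2 * a ^ 2 := by linarith
  have : a * m ≤ a * (7.1274 - 2 * a ^ 2) := by gcongr
  nlinarith [mul_nonneg h0 (sq_nonneg (a - 1.09)), sq_nonneg (a - 1.09)]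

theorem gamma_bound (g : ℂ) (hg : g ^ 2 - 3 / 2 * g - 11 / 16 = 0) :
    0.67 * g.re + 0.61 ≤ ‖g‖ := by
  have h5 : ((Real.sqrt 5 : ℝ) : ℂ) ^ 2 = 5 := by
    rw [← Complex.ofReal_pow, Real.sq_sqrt (by norm_num)]; simp
  have h1 : (g - 3 / 4 - Real.sqrt 5 / 2) * (g - 3 / 4 + Real.sqrt 5 / 2) = 0 := by
    linear_combination hg - h5 / 4
  have hs := Real.sq_sqrt (show (0 : ℝ) ≤ 5 by norm_num)
  have hs0 := Real.sqrt_nonneg 5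
  have hs1 : Real.sqrt 5 < 2.237 := by nlinarith
  have hs2 : 2.236 < Real.sqrt 5 := by nlinarith
  rcases mul_eq_zero.mp h1 with h | h
  · have hg : g = ((3 / 4 + Real.sqrt 5 / 2 : ℝ) : ℂ) := by push_cast; linear_combination h
    have := Complex.re_le_norm g
    have h2 : g.re = 3 / 4 + Real.sqrt 5 / 2 := by rw [hg, Complex.ofReal_re]
    rw [h2] at this ⊢
    linarith
  · have hg : g = ((3 / 4 - Real.sqrt 5 / 2 : ℝ) : ℂ) := by push_cast; linear_combination h
    have := (abs_le.mp (Complex.abs_re_le_norm g)).1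
    have h2 : g.re = 3 / 4 - Real.sqrt 5 / 2 := by rw [hg, Complex.ofReal_re]
    rw [h2] at this ⊢
    linarith

section
variable {K : Type*} [Field K] [NumberField K]

theorem quartic_short (hn : Module.finrank ℚ K = 4) (e : Fin 4 ≃ (K →ₐ[ℚ] ℂ)) (hD : |discr K| ≤ 76) :
    ∃ α : 𝓞 K, 0 < (inner ℝ (psi e α) (psi e α) : ℝ) ∧
      (inner ℝ (psi e α) (psi e α) : ℝ) ≤ 3.5637 := by
  obtain ⟨b, hb⟩ := exists_int_basis_one (K := K) 3 hn
  have hg := det_gram e b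
  have hD0 : (0 : ℝ) < |(discr K : ℝ)| := by
    rw [abs_pos]
    exact_mod_cast discr_ne_zero K
  have hD1 : |(discr K : ℝ)| ≤ 76 := by exact_mod_cast hD
  have h00 := inner_one e 1
  rw [trace_one' e] at h00
  obtain ⟨u, ⟨α, rfl⟩, huv, hu⟩ := hermite_three (psi e).range (|(discr K : ℝ)| / 4) (by positivity)
    _ (fun u v w => rfl)
    ⟨psi e (b 1), ⟨_, rfl⟩, psi e (b 2), ⟨_, rfl⟩, psi e (b 3), ⟨_, rfl⟩, by
      rw [← hg, Matrix.det_succ_row_zero]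
      simp only [Fin.sum_univ_four, Matrix.det_fin_three, Matrix.submatrix_apply, Matrix.of_apply]
      simp only [show (Fin.succ 0 : Fin 4) = 1 from rfl, show (Fin.succ 1 : Fin 4) = 2 from rfl,
        show (Fin.succ 2 : Fin 4) = 3 from rfl,
        show Fin.succAbove (0 : Fin 4) 0 = 1 from rfl, show Fin.succAbove (0 : Fin 4) 1 = 2 from rfl,
        show Fin.succAbove (0 : Fin 4) 2 = 3 from rfl,
        show Fin.succAbove (1 : Fin 4) 0 = 0 from rfl, show Fin.succAbove (1 : Fin 4) 1 = 2 from rfl,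
        show Fin.succAbove (1 : Fin 4) 2 = 3 from rfl,
        show Fin.succAbove (2 : Fin 4) 0 = 0 from rfl, show Fin.succAbove (2 : Fin 4) 1 = 1 from rfl,
        show Fin.succAbove (2 : Fin 4) 2 = 3 from rfl,
        show Fin.succAbove (3 : Fin 4) 0 = 0 from rfl, show Fin.succAbove (3 : Fin 4) 1 = 1 from rfl,
        show Fin.succAbove (3 : Fin 4) 2 = 2 from rfl]
      simp only [hb, inner_psi (n := 4) (by norm_num)]
      have h1 := inner_one e (b 1)
      have h2 := inner_one e (b 2)
      have h3 := inner_one e (b 3)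
      have h1' := h1
      have h2' := h2
      have h3' := h3
      rw [real_inner_comm] at h1' h2' h3'
      have h12 := real_inner_comm (phi e (b 1)) (phi e (b 2))
      have h13 := real_inner_comm (phi e (b 1)) (phi e (b 3))
      have h23 := real_inner_comm (phi e (b 2)) (phi e (b 3))
      rw [h1, h2, h3, h1', h2', h3', h00, ← h12, ← h13, ← h23]
      norm_num
      ring⟩
  refine ⟨α, huv, ?_⟩
  by_contra! hc
  have h1 : (3.5637 : ℝ) ^ 3 ≤ (inner ℝ (psi e α) (psi e α) : ℝ) ^ 3 := by gcongr
  have h2 : (45.2588 : ℝ) ≤ 3.5637 ^ 3 := by norm_num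
  linarith

theorem quartic_omega (hn : Module.finrank ℚ K = 4) (hD : |discr K| ≤ 76) :
    ∃ α : 𝓞 K, α ^ 2 - α + 1 = 0 := by
  obtain ⟨e⟩ := exists_emb_equiv (K := K) 4 hn
  obtain ⟨α₀, h0, hQ⟩ := quartic_short hn e hD
  obtain ⟨α, hα, ht0, ht1⟩ := shift_trace (by norm_num) e α₀
  rw [← hα] at h0 hQ
  refine ⟨α, ?_⟩
  have hs := sq_norm_emb (by norm_num) e α
  have htr := trace_emb e α
  have hnm := norm_emb e α
  have hnm1 := norm_emb e (1 - α)
  have hnm2 := norm_emb e (1 + α)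
  have hN0 : ∀ m : ℤ, Algebra.norm ℤ ((m : 𝓞 K) - α) ≠ 0 := by
    intro m hm
    rw [Algebra.norm_eq_zero_iff] at hm
    rw [← sub_eq_zero.mp hm, psi_int (by norm_num)] at h0
    simp at h0
  have hN1 := hN0 1
  have hN := hN0 0
  simp only [Int.cast_zero, zero_sub, Int.cast_one] at hN hN1
  have hN' : Algebra.norm ℤ α ≠ 0 := by
    intro h
    rw [Algebra.norm_eq_zero_iff] at h
    apply hN
    rw [h]; simp
  suffices hgoal : (e 0 (α : K)) ^ 2 - e 0 (α : K) + 1 = 0 by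
    apply RingOfIntegers.ext
    apply (e 0).injective
    simpa using hgoal
  have hintg : ∀ i, IsIntegral ℤ (e i (α : K)) := fun i =>
    map_isIntegral_int ((e i) : K →+* ℂ) α.isIntegral_coe
  generalize Algebra.norm ℤ α = N at *
  generalize Algebra.norm ℤ (1 - α) = M at *
  generalize Algebra.norm ℤ (1 + α) = P at *
  generalize Algebra.trace ℤ (𝓞 K) α = t at *
  simp only [map_sub, map_one, map_add] at hnm1 hnm2
  have hi0 := hintg 0
  have hi1 := hintg 1
  have hi2 := hintg 2
  have hi3 := hintg 3
  clear hintg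
  generalize hz0 : e 0 (α : K) = z0 at *
  generalize hz1 : e 1 (α : K) = z1 at *
  generalize hz2 : e 2 (α : K) = z2 at *
  generalize hz3 : e 3 (α : K) = z3 at *
  simp only [Fin.sum_univ_four, Fin.prod_univ_four, hz0, hz1, hz2, hz3] at hs htr hnm hnm1 hnm2
  generalize inner ℝ (psi e α) (psi e α) = Q at *
  clear hz0 hz1 hz2 hz3 hα hN0 hN hD h0
  push_cast at hs ht1
  -- the second elementary symmetric function is an integer
  obtain ⟨q, hq⟩ : ∃ q : ℤ, z0 * z1 + z0 * z2 + z0 * z3 + z1 * z2 + z1 * z3 + z2 * z3 = (q : ℂ) := by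
    have h1 : z0 * z1 + z0 * z2 + z0 * z3 + z1 * z2 + z1 * z3 + z2 * z3 =
        algebraMap ℚ ℂ (((M + P - 2 - 2 * N : ℤ) : ℚ) / 2) := by
      rw [eq_ratCast]; push_cast
      rw [← hnm1, ← hnm2, ← hnm]; ring
    have h2 : IsIntegral ℤ (z0 * z1 + z0 * z2 + z0 * z3 + z1 * z2 + z1 * z3 + z2 * z3) := by
      exact (((((hi0.mul hi1).add (hi0.mul hi2)).add (hi0.mul hi3)).add (hi1.mul hi2)).add
        (hi1.mul hi3)).add (hi2.mul hi3)
    rw [h1] at h2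
    have h3 := (isIntegral_algebraMap_iff (algebraMap ℚ ℂ).injective).mp h2
    obtain ⟨m, hm⟩ := IsIntegrallyClosed.isIntegral_iff.mp h3
    refine ⟨m, ?_⟩
    rw [h1, ← hm]; simp
  have key : ∀ N : ℤ, N ≠ 0 → ∀ y0 y1 y2 y3 : ℂ, y0 * y1 * y2 * y3 = (N : ℂ) →
      (1 : ℝ) ≤ ((‖y0‖ ^ 2 + ‖y1‖ ^ 2 + ‖y2‖ ^ 2 + ‖y3‖ ^ 2) / 4) ^ 4 ∧
      (‖y0‖ ^ 2 + ‖y1‖ ^ 2 + ‖y2‖ ^ 2 + ‖y3‖ ^ 2 ≤ 4.5637 → N = 1 ∨ N = -1) := by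
    intro N hN y0 y1 y2 y3 hy
    have h1 := four_prod_bound y0 y1 y2 y3
    rw [hy, Complex.norm_intCast, sq_abs] at h1
    have h2 : 1 ≤ N ^ 2 := by
      have : 0 < N ^ 2 := by positivity
      omega
    have h2' : (1 : ℝ) ≤ (N : ℝ) ^ 2 := by exact_mod_cast h2
    refine ⟨h2'.trans h1, fun hle => ?_⟩
    have h3 : ((‖y0‖ ^ 2 + ‖y1‖ ^ 2 + ‖y2‖ ^ 2 + ‖y3‖ ^ 2) / 4) ^ 4 ≤ (4.5637 / 4) ^ 4 := by gcongr
    norm_num at h3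
    have h4 : (N : ℝ) ^ 2 < 2 := by linarith
    have h5 : N ^ 2 < 2 := by exact_mod_cast h4
    have h6 : N ≤ 1 := by nlinarith
    have h7 : -1 ≤ N := by nlinarith
    omega
  have hT4 : 4 ≤ ‖z0‖ ^ 2 + ‖z1‖ ^ 2 + ‖z2‖ ^ 2 + ‖z3‖ ^ 2 := by
    have h1 := (key N hN' z0 z1 z2 z3 hnm).1
    by_contra! hc
    have h2 : (‖z0‖ ^ 2 + ‖z1‖ ^ 2 + ‖z2‖ ^ 2 + ‖z3‖ ^ 2) / 4 < 1 := by linarith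
    have h3 := pow_lt_one₀ (by positivity) h2 (show 4 ≠ 0 by norm_num)
    linarith
  have ht : t = 2 := by
    have : t = 0 ∨ t = 1 ∨ t = 2 := by omega
    rcases this with rfl | rfl | rfl
    · exfalso; norm_num at hs; linarith
    · exfalso; norm_num at hs; linarith
    · rfl
  subst ht
  have hsu : ‖z0 - 1 / 2‖ ^ 2 + ‖z1 - 1 / 2‖ ^ 2 + ‖z2 - 1 / 2‖ ^ 2 + ‖z3 - 1 / 2‖ ^ 2 = Q := by
    have hre := congrArg Complex.re htr
    simp only [nsq] at hs ⊢
    simp at hs hre ⊢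
    norm_num at hs hre ⊢
    linarith
  have hs1 : ‖1 - z0‖ ^ 2 + ‖1 - z1‖ ^ 2 + ‖1 - z2‖ ^ 2 + ‖1 - z3‖ ^ 2 = Q + 1 := by
    have hre := congrArg Complex.re htr
    simp only [nsq] at hs ⊢
    simp at hs hre ⊢
    norm_num at hs hre ⊢
    linarith
  have hNN := (key N hN' z0 z1 z2 z3 hnm).2 (by rw [hs]; norm_num; linarith)
  have hMM := (key M hN1 _ _ _ _ hnm1).2 (by rw [hs1]; linarith)
  obtain ⟨u0, rfl⟩ : ∃ u, z0 = u + 1 / 2 := ⟨z0 - 1 / 2, by ring⟩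
  obtain ⟨u1, rfl⟩ : ∃ u, z1 = u + 1 / 2 := ⟨z1 - 1 / 2, by ring⟩
  obtain ⟨u2, rfl⟩ : ∃ u, z2 = u + 1 / 2 := ⟨z2 - 1 / 2, by ring⟩
  obtain ⟨u3, rfl⟩ : ∃ u, z3 = u + 1 / 2 := ⟨z3 - 1 / 2, by ring⟩
  simp only [add_sub_cancel_right] at hsu
  clear hs hs1 hi0 hi1 hi2 hi3 key hT4 hnm2
  have hE1 : u0 + u1 + u2 + u3 = 0 := by push_cast at htr; linear_combination htr
  have hE2 : u0 * u1 + u0 * u2 + u0 * u3 + u1 * u2 + u1 * u3 + u2 * u3 = (q : ℂ) - 3 / 2 := by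
    linear_combination hq - 3 / 2 * hE1
  have hE3 : u0 * u1 * (u2 + u3) + u2 * u3 * (u0 + u1) = ((N - M : ℤ) : ℂ) := by
    push_cast; rw [← hnm, ← hnm1]; linear_combination (-1 / 4) * hE1
  have hE4 : u0 * u1 * u2 * u3 + (u0 * u1 * (u2 + u3) + u2 * u3 * (u0 + u1)) / 2 +
      ((q : ℂ) - 3 / 2) / 4 + 1 / 16 = N := by
    rw [← hE2, ← hnm]; linear_combination (-1 / 8) * hE1
  have hNM : N = M := by
    have h1 := e3_bound u0 u1 u2 u3 hE1 (by rw [hsu]; exact hQ)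
    rw [hE3, Complex.norm_intCast] at h1
    have h2 : |N - M| < 2 := by exact_mod_cast h1
    rw [abs_lt] at h2
    omega
  rw [hE3, hNM] at hE4
  subst hNM
  rw [sub_self] at hE3
  have hqb : |2 * q - 3| ≤ 3 := by
    have h1 : ((2 * q - 3 : ℤ) : ℂ) = - (u0 ^ 2 + u1 ^ 2 + u2 ^ 2 + u3 ^ 2) := by
      push_cast
      linear_combination (-2) * hE2 + (u0 + u1 + u2 + u3) * hE1
    have h2 : ‖((2 * q - 3 : ℤ) : ℂ)‖ ≤ Q := by
      rw [h1, norm_neg, ← hsu, ← norm_pow, ← norm_pow, ← norm_pow, ← norm_pow]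
      exact (norm_add_le _ _).trans (add_le_add norm_add₃_le le_rfl)
    rw [Complex.norm_intCast] at h2
    have h3 : ((|2 * q - 3| : ℤ) : ℝ) < (4 : ℤ) := by
      push_cast at h2 ⊢; linarith
    have := Int.cast_lt.mp h3
    omega
  have hE4b : |(16 * N - 4 * q + 5 : ℤ)| ≤ 12 := by
    have h1 : ((16 * N - 4 * q + 5 : ℤ) : ℂ) = 16 * (u0 * u1 * u2 * u3) := by
      push_cast
      push_cast at hE4
      linear_combination (-16) * hE4
    have h2 := four_prod_bound u0 u1 u2 u3
    rw [hsu] at h2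
    have hQ0 : 0 ≤ Q := by rw [← hsu]; positivity
    have h3 : ‖u0 * u1 * u2 * u3‖ ≤ (Q / 4) ^ 2 := by
      apply le_of_sq_le_sq _ (by positivity)
      linarith
    have h4 : (Q / 4) ^ 2 ≤ (3.5637 / 4) ^ 2 := by gcongr
    have h5 : ‖((16 * N - 4 * q + 5 : ℤ) : ℂ)‖ = 16 * ‖u0 * u1 * u2 * u3‖ := by
      rw [h1, norm_mul]; simp
    rw [Complex.norm_intCast] at h5
    have h6 : ((|16 * N - 4 * q + 5| : ℤ) : ℝ) < (13 : ℤ) := by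
      push_cast at h5 ⊢; rw [h5]; norm_num at h4; linarith
    have := Int.cast_lt.mp h6
    omega
  have hroot : ∀ u : ℂ, (u - u0) * (u - u1) * (u - u2) * (u - u3) = 0 →
      u ^ 4 + ((q : ℂ) - 3 / 2) * u ^ 2 + u0 * u1 * u2 * u3 = 0 := by
    intro u hu
    push_cast at hE3
    linear_combination hu + u ^ 3 * hE1 - u ^ 2 * hE2 + u * hE3
  rw [abs_le] at hqb hE4b
  rcases hNN with rfl | rfl
  · have hq3 : q = 3 := by omega
    subst hq3
    have h1 := hroot u0 (by ring)
    push_cast at hE4 h1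
    have h2 : (u0 ^ 2 + 3 / 4) ^ 2 = 0 := by linear_combination h1 - hE4
    have h3 := pow_eq_zero_iff (two_ne_zero) |>.mp h2
    linear_combination h3
  · exfalso
    have hq3 : q = 0 := by omega
    subst hq3
    push_cast at hE4
    have hg : ∀ u : ℂ, (u - u0) * (u - u1) * (u - u2) * (u - u3) = 0 →
        0.67 * (u ^ 2).re + 0.61 ≤ ‖u‖ ^ 2 := by
      intro u hu
      have h1 := hroot u hu
      push_cast at h1
      rw [← norm_pow]
      apply gamma_bound
      linear_combination h1 - hE4
    have g0 := hg u0 (by ring)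
    have g1 := hg u1 (by ring)
    have g2 := hg u2 (by ring)
    have g3 := hg u3 (by ring)
    have h3 : (u0 ^ 2 + u1 ^ 2 + u2 ^ 2 + u3 ^ 2 : ℂ) = (3 : ℝ) := by
      push_cast at hE2 ⊢
      linear_combination (-2) * hE2 + (u0 + u1 + u2 + u3) * hE1
    have h4 := congrArg Complex.re h3
    rw [Complex.ofReal_re, Complex.add_re, Complex.add_re, Complex.add_re] at h4
    linarith
end

theorem quartic_basis_aux (F : Type) [Field F] [NumberField F] [IsCyclotomicExtension {3} ℚ F]
    {K : Type*} [Field K] [NumberField K] (hn : Module.finrank ℚ K = 4) (α : 𝓞 K)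
    (hα : α ^ 2 - α + 1 = 0) :
    ∃ (z β : 𝓞 K) (a0 a1 b0 b1 : ℤ) (B : Module.Basis (Fin 4) ℤ (𝓞 K)),
      z ^ 2 + z + 1 = 0 ∧ β ^ 2 = (a0 + a1 * z) * β + (b0 + b1 * z) ∧
      B 0 = 1 ∧ B 1 = z ∧ B 2 = β ∧ B 3 = z * β := by
  have hζ := IsCyclotomicExtension.zeta_spec 3 ℚ F
  set ζ := IsCyclotomicExtension.zeta 3 ℚ F
  have : IsPrincipalIdealRing (𝓞 F) := IsCyclotomicExtension.Rat.three_pid F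
  have hz3 : IsPrimitiveRoot (-(α : K)) 3 := by
    have h1 : (α : K) ^ 2 - α + 1 = 0 := by
      have := congrArg (algebraMap (𝓞 K) K) hα
      simpa using this
    have : Polynomial.IsRoot (Polynomial.cyclotomic 3 K) (-(α : K)) := by
      rw [Polynomial.cyclotomic_three]
      simp
      linear_combination h1
    exact Polynomial.isRoot_cyclotomic_iff.mp this
  let φ : F →ₐ[ℚ] K := (hζ.powerBasis ℚ).lift (-(α : K)) (by
    rw [IsPrimitiveRoot.powerBasis_gen (K := ℚ) hζ, ← Polynomial.cyclotomic_eq_minpoly_rat hζ (by norm_num)]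
    rw [Polynomial.aeval_def, Polynomial.eval₂_eq_eval_map, Polynomial.map_cyclotomic]
    exact hz3.isRoot_cyclotomic (by norm_num))
  let : Algebra F K := φ.toRingHom.toAlgebra
  let pb := hζ.integralPowerBasis
  have hdim : pb.dim = 2 := by
    simp [pb]; decide
  let c : Module.Basis (Fin 2) ℤ (𝓞 F) := pb.basis.reindex (finCongr hdim)
  have hc0 : c 0 = 1 := by simp [c]
  set y := hζ.toInteger with hy
  have hc1 : c 1 = y := by simp [c, pb, hy]
  have hy2 : y ^ 2 + y + 1 = 0 := by
    have h3 := hζ.toInteger_isPrimitiveRoot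
    have h4 := h3.isRoot_cyclotomic (by norm_num)
    rw [Polynomial.cyclotomic_three] at h4
    simpa using h4
  have : Module.Free (𝓞 F) (𝓞 K) := inferInstance
  have hrank : Module.finrank (𝓞 F) (𝓞 K) = 1 + 1 := by
    have h1 := Module.finrank_mul_finrank ℤ (𝓞 F) (𝓞 K)
    rw [RingOfIntegers.rank K, hn, Module.finrank_eq_card_basis c] at h1
    simp at h1
    omega
  obtain ⟨b, hb⟩ := exists_basis_one 1 hrank (by
    rintro r x hr ⟨s, hs⟩
    have h1 : algebraMap F K r * (x : K) = algebraMap F K s := by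
      have := congrArg (algebraMap (𝓞 K) K) hs
      rw [Algebra.smul_def, map_mul] at this
      exact this
    have hr' : (algebraMap F K r) ≠ 0 := by simpa using hr
    have h2 : (x : K) = algebraMap F K (s / r) := by
      rw [map_div₀, eq_div_iff hr', mul_comm]; exact h1
    have h3 : IsIntegral ℤ ((s : F) / r) := by
      have h4 := x.isIntegral_coe
      change IsIntegral ℤ (x : K) at h4
      rw [h2] at h4
      exact (isIntegral_algebraMap_iff (algebraMap F K).injective).mp h4
    refine ⟨⟨_, h3⟩, ?_⟩
    apply RingOfIntegers.ext
    rw [h2]; rfl)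
  let B := (c.smulTower b).reindex ((Equiv.prodComm _ _).trans finProdFinEquiv : _ ≃ Fin 4)
  have hrep : ∀ r : 𝓞 F, ∃ p q : ℤ, algebraMap (𝓞 F) (𝓞 K) r = p + q * algebraMap (𝓞 F) (𝓞 K) y := by
    intro r
    refine ⟨c.repr r 0, c.repr r 1, ?_⟩
    have := c.sum_repr r
    rw [Fin.sum_univ_two, hc0, hc1] at this
    conv_lhs => rw [← this]
    simp
  have hsq := b.sum_repr (b 1 ^ 2)
  rw [Fin.sum_univ_two, hb] at hsq
  obtain ⟨b0, b1, h0⟩ := hrep (b.repr (b 1 ^ 2) 0)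
  obtain ⟨a0, a1, h1⟩ := hrep (b.repr (b 1 ^ 2) 1)
  rw [Algebra.smul_def, Algebra.smul_def, h0, h1] at hsq
  refine ⟨algebraMap (𝓞 F) (𝓞 K) y, b 1, a0, a1, b0, b1, B, ?_, ?_, ?_, ?_, ?_, ?_⟩
  · have := congrArg (algebraMap (𝓞 F) (𝓞 K)) hy2
    simpa using this
  · linear_combination -hsq
  · have : B 0 = c 0 • b 0 := by
      rw [Module.Basis.reindex_apply, Module.Basis.smulTower_apply]; rfl
    rw [this, hc0, hb, one_smul]
  · have : B 1 = c 1 • b 0 := by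
      rw [Module.Basis.reindex_apply, Module.Basis.smulTower_apply]; rfl
    rw [this, hc1, hb, Algebra.smul_def, mul_one]
  · have : B 2 = c 0 • b 1 := by
      rw [Module.Basis.reindex_apply, Module.Basis.smulTower_apply]; rfl
    rw [this, hc0, one_smul]
  · have : B 3 = c 1 • b 1 := by
      rw [Module.Basis.reindex_apply, Module.Basis.smulTower_apply]; rfl
    rw [this, hc1, Algebra.smul_def]

theorem quartic_basis {K : Type*} [Field K] [NumberField K] (hn : Module.finrank ℚ K = 4) (α : 𝓞 K)
    (hα : α ^ 2 - α + 1 = 0) :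
    ∃ (z β : 𝓞 K) (a0 a1 b0 b1 : ℤ) (B : Module.Basis (Fin 4) ℤ (𝓞 K)),
      z ^ 2 + z + 1 = 0 ∧ β ^ 2 = (a0 + a1 * z) * β + (b0 + b1 * z) ∧
      B 0 = 1 ∧ B 1 = z ∧ B 2 = β ∧ B 3 = z * β :=
  have : IsCyclotomicExtension {3} ℚ (CyclotomicField 3 ℚ) :=
    CyclotomicField.isCyclotomicExtension 3 ℚ
  quartic_basis_aux (CyclotomicField 3 ℚ) hn α hα

/-- Arithmetic of Eisenstein integers. -/
theorem eis_arith (a0 a1 b0 b1 d0 d1 : ℤ) (h0 : d0 = a0 ^ 2 - a1 ^ 2 + 4 * b0)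
    (h1 : d1 = 2 * a0 * a1 - a1 ^ 2 + 4 * b1) (hm : d0 ^ 2 - d0 * d1 + d1 ^ 2 ≠ 0)
    (hm8 : d0 ^ 2 - d0 * d1 + d1 ^ 2 ≤ 8) :
    (d0 = 1 ∧ d1 = 0) ∨ (d0 = 0 ∧ d1 = 1) ∨ (d0 = -1 ∧ d1 = -1) := by
  have hd0 : -3 ≤ d0 ∧ d0 ≤ 3 := by
    constructor <;> nlinarith [sq_nonneg (2 * d1 - d0)]
  have hd1 : -3 ≤ d1 ∧ d1 ≤ 3 := by
    constructor <;> nlinarith [sq_nonneg (2 * d0 - d1)]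
  obtain ⟨x0, i0, hx0, rfl⟩ : ∃ x i : ℤ, (i = 0 ∨ i = 1) ∧ a0 = 2 * x + i :=
    ⟨a0 / 2, a0 % 2, by omega, by omega⟩
  obtain ⟨x1, i1, hx1, rfl⟩ : ∃ x i : ℤ, (i = 0 ∨ i = 1) ∧ a1 = 2 * x + i :=
    ⟨a1 / 2, a1 % 2, by omega, by omega⟩
  obtain ⟨y0, hy0⟩ : ∃ y : ℤ, d0 = i0 ^ 2 - i1 ^ 2 + 4 * y :=
    ⟨x0 ^ 2 + x0 * i0 - x1 ^ 2 - x1 * i1 + b0, by rw [h0]; ring⟩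
  obtain ⟨y1, hy1⟩ : ∃ y : ℤ, d1 = 2 * i0 * i1 - i1 ^ 2 + 4 * y :=
    ⟨2 * x0 * x1 + x0 * i1 + x1 * i0 - x1 ^ 2 - x1 * i1 + b1, by rw [h1]; ring⟩
  clear h0 h1
  obtain ⟨p1, p2⟩ := hd0
  obtain ⟨p3, p4⟩ := hd1
  rcases hx0 with rfl | rfl <;> rcases hx1 with rfl | rfl <;> norm_num at hy0 hy1 <;>
    interval_cases d0 <;> interval_cases d1 <;> omega

theorem quad_diff (A B y y' : ℂ) (h : y ^ 2 = A * y + B) (h' : y' ^ 2 = A * y' + B) (hne : y ≠ y') :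
    (y - y') ^ 2 = A ^ 2 + 4 * B := by
  have h1 : y + y' = A := by
    have : (y - y') * (y + y' - A) = 0 := by linear_combination h - h'
    rcases mul_eq_zero.mp this with h2 | h2
    · exact absurd (sub_eq_zero.mp h2) hne
    · linear_combination h2
  linear_combination 2 * h + 2 * h' - (y + y' - A) * h1 

theorem quartic_pair (w w' y0 y1 y2 y3 : ℂ) (a0 a1 b0 b1 D : ℤ) (hw : w ^ 2 + w + 1 = 0)
    (hw' : w' = -1 - w)
    (h0 : y0 ^ 2 = (a0 + a1 * w) * y0 + (b0 + b1 * w))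
    (h1 : y1 ^ 2 = (a0 + a1 * w) * y1 + (b0 + b1 * w))
    (h2 : y2 ^ 2 = (a0 + a1 * w') * y2 + (b0 + b1 * w'))
    (h3 : y3 ^ 2 = (a0 + a1 * w') * y3 + (b0 + b1 * w'))
    (hD : (D : ℂ) = (((w - w') ^ 2) * (y0 - y1) * (y2 - y3)) ^ 2) (hD0 : D ≠ 0) (d0 d1 : ℤ)
    (hd0 : d0 = a0 ^ 2 - a1 ^ 2 + 4 * b0)
    (hd1 : d1 = 2 * a0 * a1 - a1 ^ 2 + 4 * b1) :
    D = 9 * (d0 ^ 2 - d0 * d1 + d1 ^ 2) ∧ y0 ≠ y1 := by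
  have hne : y0 ≠ y1 := by
    rintro rfl
    simp at hD; exact hD0 hD
  have hne' : y2 ≠ y3 := by
    rintro rfl
    simp at hD; exact hD0 hD
  refine ⟨?_, hne⟩
  have e1 := quad_diff _ _ _ _ h0 h1 hne
  have e2 := quad_diff _ _ _ _ h2 h3 hne'
  have e3 : (w - w') ^ 2 = -3 := by rw [hw']; linear_combination 4 * hw
  have e1' : (y0 - y1) ^ 2 = d0 + d1 * w := by
    rw [e1, hd0, hd1]; push_cast; linear_combination (a1 : ℂ) ^ 2 * hw
  have e2' : (y2 - y3) ^ 2 = d0 + d1 * w' := by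
    rw [e2, hd0, hd1, hw']; push_cast; linear_combination (a1 : ℂ) ^ 2 * hw
  have : (D : ℂ) = ((9 * (d0 ^ 2 - d0 * d1 + d1 ^ 2) : ℤ) : ℂ) := by
    rw [hD, e3, mul_pow, mul_pow, e1', e2', hw']
    push_cast
    linear_combination (-9 * (d1 : ℂ) ^ 2) * hw
  exact_mod_cast this

theorem det_four (Z Y : Fin 4 → ℂ) :
    (Matrix.of ![fun _ => 1, Z, Y, fun j => Z j * Y j]).det =
      Z 1 * Y 2 * (Z 3 * Y 3) - Z 1 * Y 3 * (Z 2 * Y 2) - Z 2 * Y 1 * (Z 3 * Y 3)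
        + Z 2 * Y 3 * (Z 1 * Y 1) + Z 3 * Y 1 * (Z 2 * Y 2) - Z 3 * Y 2 * (Z 1 * Y 1)
      - (Z 0 * Y 2 * (Z 3 * Y 3) - Z 0 * Y 3 * (Z 2 * Y 2) - Z 2 * Y 0 * (Z 3 * Y 3)
        + Z 2 * Y 3 * (Z 0 * Y 0) + Z 3 * Y 0 * (Z 2 * Y 2) - Z 3 * Y 2 * (Z 0 * Y 0))
      + (Z 0 * Y 1 * (Z 3 * Y 3) - Z 0 * Y 3 * (Z 1 * Y 1) - Z 1 * Y 0 * (Z 3 * Y 3)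
        + Z 1 * Y 3 * (Z 0 * Y 0) + Z 3 * Y 0 * (Z 1 * Y 1) - Z 3 * Y 1 * (Z 0 * Y 0))
      - (Z 0 * Y 1 * (Z 2 * Y 2) - Z 0 * Y 2 * (Z 1 * Y 1) - Z 1 * Y 0 * (Z 2 * Y 2)
        + Z 1 * Y 2 * (Z 0 * Y 0) + Z 2 * Y 0 * (Z 1 * Y 1) - Z 2 * Y 1 * (Z 0 * Y 0)) := by
  rw [Matrix.det_succ_row_zero]
  simp only [Fin.sum_univ_four, Matrix.det_fin_three, Matrix.submatrix_apply, Matrix.of_apply]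
  simp [Fin.succAbove, Fin.lt_def]
  ring

theorem quartic_bound {K : Type*} [Field K] [NumberField K] (hn : Module.finrank ℚ K = 4) :
    77 ≤ |discr K| := by
  by_contra! hD
  have hD : |discr K| ≤ 76 := by omega
  obtain ⟨α, hα⟩ := quartic_omega hn hD
  obtain ⟨z, β, a0, a1, b0, b1, B, hz, hβ, hB0, hB1, hB2, hB3⟩ := quartic_basis hn α hα
  obtain ⟨e⟩ := exists_emb_equiv (K := K) 4 hn
  have hdisc := discr_det e B
  have hD0 := discr_ne_zero K
  have hmat : (Matrix.of fun i j => e j ((B i : 𝓞 K) : K)) =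
      Matrix.of ![fun _ => 1, fun j => e j (z : K), fun j => e j (β : K),
        fun j => e j (z : K) * e j (β : K)] := by
    ext i j
    fin_cases i
    · simp [hB0]
    · simp [hB1]
    · simp [hB2]
    · simp [hB3]
  rw [hmat, det_four] at hdisc
  have hzi : ∀ i, (e i (z : K)) ^ 2 + e i (z : K) + 1 = 0 := by
    intro i
    have := congrArg (fun x : 𝓞 K => e i (x : K)) hz
    simpa using this
  have hyi : ∀ i, (e i (β : K)) ^ 2 = (a0 + a1 * e i (z : K)) * e i (β : K) +
      (b0 + b1 * e i (z : K)) := by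
    intro i
    have := congrArg (fun x : 𝓞 K => e i (x : K)) hβ
    simpa using this
  have hlin : ∀ p : 𝓞 K, (∃ m n : ℤ, p = m + n * z) → 2 * β = p → ∀ i j, e i (z : K) = e j (z : K) →
      e i (β : K) = e j (β : K) := by
    rintro p ⟨m, n, rfl⟩ hp i j hij
    have h1 := congrArg (fun x : 𝓞 K => e i (x : K)) hp
    have h2 := congrArg (fun x : 𝓞 K => e j (x : K)) hp
    simp only [two_mul, map_add, map_mul, map_intCast] at h1 h2
    change e i (β : K) + e i (β : K) = _ + _ * e i (z : K) at h1
    change e j (β : K) + e j (β : K) = _ + _ * e j (z : K) at h2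
    rw [hij] at h1
    linear_combination (h1 - h2) / 2
  obtain ⟨d0, hd0⟩ : ∃ d : ℤ, d = a0 ^ 2 - a1 ^ 2 + 4 * b0 := ⟨_, rfl⟩
  obtain ⟨d1, hd1⟩ : ∃ d : ℤ, d = 2 * a0 * a1 - a1 ^ 2 + 4 * b1 := ⟨_, rfl⟩
  -- main claim
  suffices hmain : discr K = 9 * (d0 ^ 2 - d0 * d1 + d1 ^ 2) ∧ ∃ i j, e i (z : K) = e j (z : K) ∧
      e i (β : K) ≠ e j (β : K) by
    obtain ⟨hdk, i, j, hij, hne⟩ := hmain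
    rw [abs_le] at hD
    have hcases := eis_arith a0 a1 b0 b1 d0 d1 hd0 hd1 (by intro h; rw [h] at hdk; omega) (by omega)
    have hsq : (2 * β - (a0 + a1 * z)) ^ 2 = d0 + d1 * z := by
      rw [hd0, hd1]; push_cast
      linear_combination 4 * hβ + (a1 : 𝓞 K) ^ 2 * hz
    have hfin : ∀ m n : ℤ, ((d0 : 𝓞 K) + d1 * z) = (m + n * z) ^ 2 → False := by
      intro m n hmn
      rw [hmn, sq_eq_sq_iff_eq_or_eq_neg] at hsq
      rcases hsq with h | h
      · exact hne (hlin (a0 + a1 * z + (m + n * z)) ⟨a0 + m, a1 + n, by push_cast; ring⟩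
          (by linear_combination h) i j hij)
      · exact hne (hlin (a0 + a1 * z - (m + n * z)) ⟨a0 - m, a1 - n, by push_cast; ring⟩
          (by linear_combination h) i j hij)
    rcases hcases with ⟨h1, h2⟩ | ⟨h1, h2⟩ | ⟨h1, h2⟩
    · exact hfin 1 0 (by rw [h1, h2]; push_cast; ring)
    · exact hfin (-1) (-1) (by rw [h1, h2]; push_cast; linear_combination (-1) * hz)
    · exact hfin 0 1 (by rw [h1, h2]; push_cast; linear_combination (-1) * hz)
  have hz01 : ∀ i j, e i (z : K) = e j (z : K) ∨ e j (z : K) = -1 - e i (z : K) := by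
    intro i j
    have : (e i (z : K) - e j (z : K)) * (e i (z : K) + e j (z : K) + 1) = 0 := by
      linear_combination hzi i - hzi j
    rcases mul_eq_zero.mp this with h | h
    · left; linear_combination h
    · right; linear_combination h
  have q0 := hzi 0
  have k0 := hyi 0
  have k1 := hyi 1
  have k2 := hyi 2
  have k3 := hyi 3
  have c01 := hz01 0 1
  have c02 := hz01 0 2
  have c03 := hz01 0 3
  suffices hmain : discr K = 9 * (d0 ^ 2 - d0 * d1 + d1 ^ 2) ∧
      ((e 0 (z : K) = e 1 (z : K) ∧ e 0 (β : K) ≠ e 1 (β : K)) ∨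
       (e 0 (z : K) = e 2 (z : K) ∧ e 0 (β : K) ≠ e 2 (β : K)) ∨
       (e 0 (z : K) = e 3 (z : K) ∧ e 0 (β : K) ≠ e 3 (β : K))) by
    refine ⟨hmain.1, ?_⟩
    rcases hmain.2 with h | h | h
    exacts [⟨_, _, h⟩, ⟨_, _, h⟩, ⟨_, _, h⟩]
  generalize discr K = D at *
  generalize e 0 (z : K) = z0 at *
  generalize e 1 (z : K) = z1 at *
  generalize e 2 (z : K) = z2 at *
  generalize e 3 (z : K) = z3 at *
  generalize e 0 (β : K) = y0 at *
  generalize e 1 (β : K) = y1 at *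
  generalize e 2 (β : K) = y2 at *
  generalize e 3 (β : K) = y3 at *
  clear hzi hyi hlin hz01
  have hDc : (D : ℂ) ≠ 0 := by exact_mod_cast hD0
  rcases c01 with h1 | h1 <;> rcases c02 with h2 | h2 <;> rcases c03 with h3 | h3 <;> subst h1 h2 h3
  · exfalso; apply hDc; rw [hdisc]; ring
  · exfalso; apply hDc; rw [hdisc]; ring
  · exfalso; apply hDc; rw [hdisc]; ring
  · have := quartic_pair _ _ _ _ _ _ a0 a1 b0 b1 D q0 rfl k0 k1 k2 k3 (by rw [hdisc]; ring) hD0 d0 d1 hd0 hd1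
    exact ⟨this.1, Or.inl ⟨rfl, this.2⟩⟩
  · exfalso; apply hDc; rw [hdisc]; ring
  · have := quartic_pair _ _ _ _ _ _ a0 a1 b0 b1 D q0 rfl k0 k2 k1 k3 (by rw [hdisc]; ring) hD0 d0 d1 hd0 hd1
    exact ⟨this.1, Or.inr (Or.inl ⟨rfl, this.2⟩)⟩
  · have := quartic_pair _ _ _ _ _ _ a0 a1 b0 b1 D q0 rfl k0 k3 k1 k2 (by rw [hdisc]; ring) hD0 d0 d1 hd0 hd1
    exact ⟨this.1, Or.inr (Or.inr ⟨rfl, this.2⟩)⟩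
  · exfalso; apply hDc; rw [hdisc]; ring

theorem fin_max (A B c m T w F : ℝ) (hm : 0 ≤ m) (hF : 0 < F)
    (h : m * (A * F - 5.0593 * B * T) ^ 2 ≤ 4 * 5.0593 * c * F * T ^ 3) :
    m * ((A - 5.0593 * w) * (w * F - B * T)) ≤ c * T ^ 3 := by
  have h1 : m * (4 * 5.0593 * F * ((A - 5.0593 * w) * (w * F - B * T))) ≤
      m * (A * F - 5.0593 * B * T) ^ 2 := by
    apply mul_le_mul_of_nonneg_left _ hm
    nlinarith [sq_nonneg (F * (A - 5.0593 * w) - 5.0593 * (w * F - B * T))]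
  have h2 : (4 * 5.0593 * F) * (m * ((A - 5.0593 * w) * (w * F - B * T))) ≤
      (4 * 5.0593 * F) * (c * T ^ 3) := by linarith
  exact le_of_mul_le_mul_left h2 (by positivity)

theorem fin_W (A B c m T w F s V : ℝ) (hm : 0 ≤ m) (hF : 0 < F) (hs : 0 < s) (hV : V ≤ w * s)
    (hvt : (A * F + 5.0593 * B * T) * s ≤ 2 * 5.0593 * F * V)
    (hbd : m * ((A * s - 5.0593 * V) * (V * F - B * s * T)) ≤ c * T ^ 3 * s ^ 2) :
    m * ((A - 5.0593 * w) * (w * F - B * T)) ≤ c * T ^ 3 := by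
  have h1 : (A * s - 5.0593 * (w * s)) * (w * s * F - B * s * T) ≤
      (A * s - 5.0593 * V) * (V * F - B * s * T) := by
    have h2 : 0 ≤ (w * s - V) * (5.0593 * F * (w * s + V) - (A * F + 5.0593 * B * T) * s) := by
      apply mul_nonneg (by linarith)
      have : 0 ≤ F * (w * s - V) := mul_nonneg hF.le (by linarith)
      nlinarith
    nlinarith
  have h3 := mul_le_mul_of_nonneg_left h1 hm
  have h4 : s ^ 2 * (m * ((A - 5.0593 * w) * (w * F - B * T))) ≤ s ^ 2 * (c * T ^ 3) := by
    nlinarith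
  exact le_of_mul_le_mul_left h4 (by positivity)

theorem log_right (T T' : ℝ) (hT' : 0 < T') (h : T' ≤ T) :
    2 * (T - T') ≤ Real.log (T / T') * (T + T') := by
  have h0 : 0 ≤ T / T' - 1 := by rw [sub_nonneg, le_div_iff₀ hT']; linarith
  have h1 := Real.le_log_one_add_of_nonneg h0
  rw [add_sub_cancel] at h1
  have hT : 0 < T := by linarith
  have h2 : 2 * (T / T' - 1) / (T / T' - 1 + 2) = 2 * (T - T') / (T + T') := by
    have h3 : T + T' ≠ 0 := by positivity
    rw [show T / T' - 1 + 2 = (T + T') / T' by field_simp; ring,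
      show T / T' - 1 = (T - T') / T' by field_simp]
    field_simp
  rw [h2, div_le_iff₀ (by linarith)] at h1
  exact h1

theorem log_left_aux (y : ℝ) (hy : 1 ≤ y) : Real.log y ≤ (y - y⁻¹) / 2 := by
  have h0 : 0 < y := by linarith
  have h := Real.add_one_le_exp 0
  -- via sinh
  have h1 : Real.log y ≤ Real.sinh (Real.log y) := Real.self_le_sinh_iff.mpr (Real.log_nonneg hy)
  rwa [Real.sinh_eq, Real.exp_neg, Real.exp_log h0] at h1

theorem log_left (T T' : ℝ) (hT : 0 < T) (h : T ≤ T') :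
    T ^ 2 - T' ^ 2 ≤ Real.log (T / T') * (2 * T * T') := by
  have hT' : 0 < T' := by linarith
  have h1 := log_left_aux (T' / T) (by rw [le_div_iff₀ hT]; linarith)
  have h2 : Real.log (T / T') = - Real.log (T' / T) := by rw [← Real.log_inv, inv_div]
  rw [h2]
  have h3 : Real.log (T' / T) * (2 * T * T') ≤ (T' / T - (T' / T)⁻¹) / 2 * (2 * T * T') := by
    gcongr
  have h4 : (T' / T - (T' / T)⁻¹) / 2 * (2 * T * T') = T' ^ 2 - T ^ 2 := by field_simp
  linarith

theorem log_lower (m : ℕ) (y q X : ℝ) (hX : 0 < X) (hq : q ≤ Real.exp (-y))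
    (h : 2.7182818286 ^ m ≤ X * q) : m + y ≤ Real.log X := by
  rw [Real.le_log_iff_exp_le hX]
  have h1 : Real.exp m ≤ 2.7182818286 ^ m := by
    rw [← Real.exp_one_pow]
    gcongr
    exact Real.exp_one_lt_d9.le
  have h2 : Real.exp m ≤ X * Real.exp (-y) :=
    h1.trans (h.trans (by gcongr))
  rw [Real.exp_neg, ← div_eq_mul_inv, le_div_iff₀ (Real.exp_pos _)] at h2
  rw [Real.exp_add]; exact h2

theorem sqrt5_lower : 2.236067 ≤ Real.sqrt 5 := by
  apply Real.le_sqrt_of_sq_le; norm_num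

theorem pm1_0 (T : ℝ) (h1 : 0 ≤ T - 13.5) :
    1^2 * ((18.7781 + 27.5673 / 1) * (T ^ 2 - 7.0604 * T - 10.1186) - 5.0593 * (21.3270 + 33.3542 / 1) * T) ^ 2 ≤ 4 * 5.0593 * 3.1517 * (T ^ 2 - 7.0604 * T - 10.1186) * T ^ 3 := by
  linarith [pow_nonneg h1 1,
    pow_nonneg h1 2,
    pow_nonneg h1 3,
    pow_nonneg h1 4,
    pow_nonneg h1 5]

theorem pm2_0 (T : ℝ) (h1 : 0 ≤ T - 13.5) (h2 : 0 ≤ 28 - T) :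
    2^2 * ((18.7781 + 27.5673 / 2) * (T ^ 2 - 7.0604 * T - 10.1186) - 5.0593 * (21.3270 + 33.3542 / 2) * T) ^ 2 ≤ 4 * 5.0593 * 3.1517 * (T ^ 2 - 7.0604 * T - 10.1186) * T ^ 3 := by
  linarith [mul_nonneg (pow_nonneg h1 0) (pow_nonneg h2 5),
    mul_nonneg (pow_nonneg h1 1) (pow_nonneg h2 4),
    mul_nonneg (pow_nonneg h1 2) (pow_nonneg h2 3),
    mul_nonneg (pow_nonneg h1 3) (pow_nonneg h2 2),
    mul_nonneg (pow_nonneg h1 4) (pow_nonneg h2 1),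
    mul_nonneg (pow_nonneg h1 5) (pow_nonneg h2 0)]

theorem pm2_1 (T : ℝ) (h1 : 0 ≤ T - 28) (h2 : 0 ≤ 40 - T) :
    2^2 * ((18.7781 + 27.5673 / 2) * (T ^ 2 - 7.0604 * T - 10.1186) - 5.0593 * (21.3270 + 33.3542 / 2) * T) ^ 2 ≤ 4 * 5.0593 * 3.1517 * (T ^ 2 - 7.0604 * T - 10.1186) * T ^ 3 := by
  linarith [mul_nonneg (pow_nonneg h1 0) (pow_nonneg h2 5),
    mul_nonneg (pow_nonneg h1 1) (pow_nonneg h2 4),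
    mul_nonneg (pow_nonneg h1 2) (pow_nonneg h2 3),
    mul_nonneg (pow_nonneg h1 3) (pow_nonneg h2 2),
    mul_nonneg (pow_nonneg h1 4) (pow_nonneg h2 1),
    mul_nonneg (pow_nonneg h1 5) (pow_nonneg h2 0)]

theorem pm2_2 (T : ℝ) (h1 : 0 ≤ T - 40) :
    2^2 * ((18.7781 + 27.5673 / 2) * (T ^ 2 - 7.0604 * T - 10.1186) - 5.0593 * (21.3270 + 33.3542 / 2) * T) ^ 2 ≤ 4 * 5.0593 * 3.1517 * (T ^ 2 - 7.0604 * T - 10.1186) * T ^ 3 := by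
  linarith [pow_nonneg h1 1,
    pow_nonneg h1 2,
    pow_nonneg h1 3,
    pow_nonneg h1 4,
    pow_nonneg h1 5]

theorem pm3_0 (T : ℝ) (h1 : 0 ≤ T - 13.5) (h2 : 0 ≤ 20.3 - T) :
    3^2 * ((18.7781 + 27.5673 / 3) * (T ^ 2 - 7.0604 * T - 10.1186) - 5.0593 * (21.3270 + 33.3542 / 3) * T) ^ 2 ≤ 4 * 5.0593 * 3.1517 * (T ^ 2 - 7.0604 * T - 10.1186) * T ^ 3 := by
  linarith [mul_nonneg (pow_nonneg h1 0) (pow_nonneg h2 5),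
    mul_nonneg (pow_nonneg h1 1) (pow_nonneg h2 4),
    mul_nonneg (pow_nonneg h1 2) (pow_nonneg h2 3),
    mul_nonneg (pow_nonneg h1 3) (pow_nonneg h2 2),
    mul_nonneg (pow_nonneg h1 4) (pow_nonneg h2 1),
    mul_nonneg (pow_nonneg h1 5) (pow_nonneg h2 0)]

theorem pv3_0 (T : ℝ) (h1 : 0 ≤ T - 20.3) (h2 : 0 ≤ 22 - T) :
    ((18.7781 + 27.5673 / 3) * (T ^ 2 - 7.0604 * T - 10.1186) + 5.0593 * (21.3270 + 33.3542 / 3) * T) * (2 * T * 22) ≤ 2 * 5.0593 * (T ^ 2 - 7.0604 * T - 10.1186) * (4.5343 * (2 * T * 22) + (T ^ 2 - 22 ^ 2)) := by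
  linarith [mul_nonneg (pow_nonneg h1 0) (pow_nonneg h2 4),
    mul_nonneg (pow_nonneg h1 1) (pow_nonneg h2 3),
    mul_nonneg (pow_nonneg h1 2) (pow_nonneg h2 2),
    mul_nonneg (pow_nonneg h1 3) (pow_nonneg h2 1),
    mul_nonneg (pow_nonneg h1 4) (pow_nonneg h2 0)]

theorem pb3_0 (T : ℝ) (h1 : 0 ≤ T - 20.3) (h2 : 0 ≤ 22 - T) :
    3^2 * (((18.7781 + 27.5673 / 3) * (2 * T * 22) - 5.0593 * (4.5343 * (2 * T * 22) + (T ^ 2 - 22 ^ 2))) * ((4.5343 * (2 * T * 22) + (T ^ 2 - 22 ^ 2)) * (T ^ 2 - 7.0604 * T - 10.1186) - (21.3270 + 33.3542 / 3) * (2 * T * 22) * T)) ≤ 3.1517 * T ^ 3 * (2 * T * 22) ^ 2 := by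
  linarith [mul_nonneg (pow_nonneg h1 0) (pow_nonneg h2 6),
    mul_nonneg (pow_nonneg h1 1) (pow_nonneg h2 5),
    mul_nonneg (pow_nonneg h1 2) (pow_nonneg h2 4),
    mul_nonneg (pow_nonneg h1 3) (pow_nonneg h2 3),
    mul_nonneg (pow_nonneg h1 4) (pow_nonneg h2 2),
    mul_nonneg (pow_nonneg h1 5) (pow_nonneg h2 1),
    mul_nonneg (pow_nonneg h1 6) (pow_nonneg h2 0)]

theorem pv3_1 (T : ℝ) (h1 : 0 ≤ T - 22) (h2 : 0 ≤ 23.4 - T) :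
    ((18.7781 + 27.5673 / 3) * (T ^ 2 - 7.0604 * T - 10.1186) + 5.0593 * (21.3270 + 33.3542 / 3) * T) * (T + 22) ≤ 2 * 5.0593 * (T ^ 2 - 7.0604 * T - 10.1186) * (4.5343 * (T + 22) + 2 * (T - 22)) := by
  linarith [mul_nonneg (pow_nonneg h1 0) (pow_nonneg h2 3),
    mul_nonneg (pow_nonneg h1 1) (pow_nonneg h2 2),
    mul_nonneg (pow_nonneg h1 2) (pow_nonneg h2 1),
    mul_nonneg (pow_nonneg h1 3) (pow_nonneg h2 0)]

theorem pb3_1 (T : ℝ) (h1 : 0 ≤ T - 22) (h2 : 0 ≤ 23.4 - T) :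
    3^2 * (((18.7781 + 27.5673 / 3) * (T + 22) - 5.0593 * (4.5343 * (T + 22) + 2 * (T - 22))) * ((4.5343 * (T + 22) + 2 * (T - 22)) * (T ^ 2 - 7.0604 * T - 10.1186) - (21.3270 + 33.3542 / 3) * (T + 22) * T)) ≤ 3.1517 * T ^ 3 * (T + 22) ^ 2 := by
  linarith [mul_nonneg (pow_nonneg h1 0) (pow_nonneg h2 5),
    mul_nonneg (pow_nonneg h1 1) (pow_nonneg h2 4),
    mul_nonneg (pow_nonneg h1 2) (pow_nonneg h2 3),
    mul_nonneg (pow_nonneg h1 3) (pow_nonneg h2 2),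
    mul_nonneg (pow_nonneg h1 4) (pow_nonneg h2 1),
    mul_nonneg (pow_nonneg h1 5) (pow_nonneg h2 0)]

theorem pv3_2 (T : ℝ) (h1 : 0 ≤ T - 23.4) (h2 : 0 ≤ 24 - T) :
    ((18.7781 + 27.5673 / 3) * (T ^ 2 - 7.0604 * T - 10.1186) + 5.0593 * (21.3270 + 33.3542 / 3) * T) * (T + 22) ≤ 2 * 5.0593 * (T ^ 2 - 7.0604 * T - 10.1186) * (4.5343 * (T + 22) + 2 * (T - 22)) := by
  linarith [mul_nonneg (pow_nonneg h1 0) (pow_nonneg h2 3),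
    mul_nonneg (pow_nonneg h1 1) (pow_nonneg h2 2),
    mul_nonneg (pow_nonneg h1 2) (pow_nonneg h2 1),
    mul_nonneg (pow_nonneg h1 3) (pow_nonneg h2 0)]

theorem pb3_2 (T : ℝ) (h1 : 0 ≤ T - 23.4) (h2 : 0 ≤ 24 - T) :
    3^2 * (((18.7781 + 27.5673 / 3) * (T + 22) - 5.0593 * (4.5343 * (T + 22) + 2 * (T - 22))) * ((4.5343 * (T + 22) + 2 * (T - 22)) * (T ^ 2 - 7.0604 * T - 10.1186) - (21.3270 + 33.3542 / 3) * (T + 22) * T)) ≤ 3.1517 * T ^ 3 * (T + 22) ^ 2 := by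
  linarith [mul_nonneg (pow_nonneg h1 0) (pow_nonneg h2 5),
    mul_nonneg (pow_nonneg h1 1) (pow_nonneg h2 4),
    mul_nonneg (pow_nonneg h1 2) (pow_nonneg h2 3),
    mul_nonneg (pow_nonneg h1 3) (pow_nonneg h2 2),
    mul_nonneg (pow_nonneg h1 4) (pow_nonneg h2 1),
    mul_nonneg (pow_nonneg h1 5) (pow_nonneg h2 0)]

theorem pv3_3 (T : ℝ) (h1 : 0 ≤ T - 24) (h2 : 0 ≤ 27 - T) :
    ((18.7781 + 27.5673 / 3) * (T ^ 2 - 7.0604 * T - 10.1186) + 5.0593 * (21.3270 + 33.3542 / 3) * T) * (T + 22) ≤ 2 * 5.0593 * (T ^ 2 - 7.0604 * T - 10.1186) * (4.5343 * (T + 22) + 2 * (T - 22)) := by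
  linarith [mul_nonneg (pow_nonneg h1 0) (pow_nonneg h2 3),
    mul_nonneg (pow_nonneg h1 1) (pow_nonneg h2 2),
    mul_nonneg (pow_nonneg h1 2) (pow_nonneg h2 1),
    mul_nonneg (pow_nonneg h1 3) (pow_nonneg h2 0)]

theorem pb3_3 (T : ℝ) (h1 : 0 ≤ T - 24) (h2 : 0 ≤ 27 - T) :
    3^2 * (((18.7781 + 27.5673 / 3) * (T + 22) - 5.0593 * (4.5343 * (T + 22) + 2 * (T - 22))) * ((4.5343 * (T + 22) + 2 * (T - 22)) * (T ^ 2 - 7.0604 * T - 10.1186) - (21.3270 + 33.3542 / 3) * (T + 22) * T)) ≤ 3.1517 * T ^ 3 * (T + 22) ^ 2 := by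
  linarith [mul_nonneg (pow_nonneg h1 0) (pow_nonneg h2 5),
    mul_nonneg (pow_nonneg h1 1) (pow_nonneg h2 4),
    mul_nonneg (pow_nonneg h1 2) (pow_nonneg h2 3),
    mul_nonneg (pow_nonneg h1 3) (pow_nonneg h2 2),
    mul_nonneg (pow_nonneg h1 4) (pow_nonneg h2 1),
    mul_nonneg (pow_nonneg h1 5) (pow_nonneg h2 0)]

theorem pv3_4 (T : ℝ) (h1 : 0 ≤ T - 27) :
    ((18.7781 + 27.5673 / 3) * (T ^ 2 - 7.0604 * T - 10.1186) + 5.0593 * (21.3270 + 33.3542 / 3) * T) * (T + 22) ≤ 2 * 5.0593 * (T ^ 2 - 7.0604 * T - 10.1186) * (4.5343 * (T + 22) + 2 * (T - 22)) := by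
  linarith [pow_nonneg h1 1,
    pow_nonneg h1 2,
    pow_nonneg h1 3]

theorem pb3_4 (T : ℝ) (h1 : 0 ≤ T - 27) :
    3^2 * (((18.7781 + 27.5673 / 3) * (T + 22) - 5.0593 * (4.5343 * (T + 22) + 2 * (T - 22))) * ((4.5343 * (T + 22) + 2 * (T - 22)) * (T ^ 2 - 7.0604 * T - 10.1186) - (21.3270 + 33.3542 / 3) * (T + 22) * T)) ≤ 3.1517 * T ^ 3 * (T + 22) ^ 2 := by
  linarith [pow_nonneg h1 1,
    pow_nonneg h1 2,
    pow_nonneg h1 3,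
    pow_nonneg h1 4,
    pow_nonneg h1 5]

theorem pm4_0 (T : ℝ) (h1 : 0 ≤ T - 13.5) (h2 : 0 ≤ 17.9 - T) :
    4^2 * ((18.7781 + 27.5673 / 4) * (T ^ 2 - 7.0604 * T - 10.1186) - 5.0593 * (21.3270 + 33.3542 / 4) * T) ^ 2 ≤ 4 * 5.0593 * 3.1517 * (T ^ 2 - 7.0604 * T - 10.1186) * T ^ 3 := by
  linarith [mul_nonneg (pow_nonneg h1 0) (pow_nonneg h2 5),
    mul_nonneg (pow_nonneg h1 1) (pow_nonneg h2 4),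
    mul_nonneg (pow_nonneg h1 2) (pow_nonneg h2 3),
    mul_nonneg (pow_nonneg h1 3) (pow_nonneg h2 2),
    mul_nonneg (pow_nonneg h1 4) (pow_nonneg h2 1),
    mul_nonneg (pow_nonneg h1 5) (pow_nonneg h2 0)]

theorem pv4_0 (T : ℝ) (h1 : 0 ≤ T - 17.9) (h2 : 0 ≤ 20 - T) :
    ((18.7781 + 27.5673 / 4) * (T ^ 2 - 7.0604 * T - 10.1186) + 5.0593 * (21.3270 + 33.3542 / 4) * T) * (T + 17.9) ≤ 2 * 5.0593 * (T ^ 2 - 7.0604 * T - 10.1186) * (4.368 * (T + 17.9) + 2 * (T - 17.9)) := by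
  linarith [mul_nonneg (pow_nonneg h1 0) (pow_nonneg h2 3),
    mul_nonneg (pow_nonneg h1 1) (pow_nonneg h2 2),
    mul_nonneg (pow_nonneg h1 2) (pow_nonneg h2 1),
    mul_nonneg (pow_nonneg h1 3) (pow_nonneg h2 0)]

theorem pb4_0 (T : ℝ) (h1 : 0 ≤ T - 17.9) (h2 : 0 ≤ 20 - T) :
    4^2 * (((18.7781 + 27.5673 / 4) * (T + 17.9) - 5.0593 * (4.368 * (T + 17.9) + 2 * (T - 17.9))) * ((4.368 * (T + 17.9) + 2 * (T - 17.9)) * (T ^ 2 - 7.0604 * T - 10.1186) - (21.3270 + 33.3542 / 4) * (T + 17.9) * T)) ≤ 3.1517 * T ^ 3 * (T + 17.9) ^ 2 := by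
  linarith [mul_nonneg (pow_nonneg h1 0) (pow_nonneg h2 5),
    mul_nonneg (pow_nonneg h1 1) (pow_nonneg h2 4),
    mul_nonneg (pow_nonneg h1 2) (pow_nonneg h2 3),
    mul_nonneg (pow_nonneg h1 3) (pow_nonneg h2 2),
    mul_nonneg (pow_nonneg h1 4) (pow_nonneg h2 1),
    mul_nonneg (pow_nonneg h1 5) (pow_nonneg h2 0)]

theorem pv4_1 (T : ℝ) (h1 : 0 ≤ T - 20) (h2 : 0 ≤ 21 - T) :
    ((18.7781 + 27.5673 / 4) * (T ^ 2 - 7.0604 * T - 10.1186) + 5.0593 * (21.3270 + 33.3542 / 4) * T) * (T + 17.9) ≤ 2 * 5.0593 * (T ^ 2 - 7.0604 * T - 10.1186) * (4.368 * (T + 17.9) + 2 * (T - 17.9)) := by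
  linarith [mul_nonneg (pow_nonneg h1 0) (pow_nonneg h2 3),
    mul_nonneg (pow_nonneg h1 1) (pow_nonneg h2 2),
    mul_nonneg (pow_nonneg h1 2) (pow_nonneg h2 1),
    mul_nonneg (pow_nonneg h1 3) (pow_nonneg h2 0)]

theorem pb4_1 (T : ℝ) (h1 : 0 ≤ T - 20) (h2 : 0 ≤ 21 - T) :
    4^2 * (((18.7781 + 27.5673 / 4) * (T + 17.9) - 5.0593 * (4.368 * (T + 17.9) + 2 * (T - 17.9))) * ((4.368 * (T + 17.9) + 2 * (T - 17.9)) * (T ^ 2 - 7.0604 * T - 10.1186) - (21.3270 + 33.3542 / 4) * (T + 17.9) * T)) ≤ 3.1517 * T ^ 3 * (T + 17.9) ^ 2 := by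
  linarith [mul_nonneg (pow_nonneg h1 0) (pow_nonneg h2 5),
    mul_nonneg (pow_nonneg h1 1) (pow_nonneg h2 4),
    mul_nonneg (pow_nonneg h1 2) (pow_nonneg h2 3),
    mul_nonneg (pow_nonneg h1 3) (pow_nonneg h2 2),
    mul_nonneg (pow_nonneg h1 4) (pow_nonneg h2 1),
    mul_nonneg (pow_nonneg h1 5) (pow_nonneg h2 0)]

theorem pv4_2 (T : ℝ) (h1 : 0 ≤ T - 21) (h2 : 0 ≤ 24 - T) :
    ((18.7781 + 27.5673 / 4) * (T ^ 2 - 7.0604 * T - 10.1186) + 5.0593 * (21.3270 + 33.3542 / 4) * T) * (T + 17.9) ≤ 2 * 5.0593 * (T ^ 2 - 7.0604 * T - 10.1186) * (4.368 * (T + 17.9) + 2 * (T - 17.9)) := by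
  linarith [mul_nonneg (pow_nonneg h1 0) (pow_nonneg h2 3),
    mul_nonneg (pow_nonneg h1 1) (pow_nonneg h2 2),
    mul_nonneg (pow_nonneg h1 2) (pow_nonneg h2 1),
    mul_nonneg (pow_nonneg h1 3) (pow_nonneg h2 0)]

theorem pb4_2 (T : ℝ) (h1 : 0 ≤ T - 21) (h2 : 0 ≤ 24 - T) :
    4^2 * (((18.7781 + 27.5673 / 4) * (T + 17.9) - 5.0593 * (4.368 * (T + 17.9) + 2 * (T - 17.9))) * ((4.368 * (T + 17.9) + 2 * (T - 17.9)) * (T ^ 2 - 7.0604 * T - 10.1186) - (21.3270 + 33.3542 / 4) * (T + 17.9) * T)) ≤ 3.1517 * T ^ 3 * (T + 17.9) ^ 2 := by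
  linarith [mul_nonneg (pow_nonneg h1 0) (pow_nonneg h2 5),
    mul_nonneg (pow_nonneg h1 1) (pow_nonneg h2 4),
    mul_nonneg (pow_nonneg h1 2) (pow_nonneg h2 3),
    mul_nonneg (pow_nonneg h1 3) (pow_nonneg h2 2),
    mul_nonneg (pow_nonneg h1 4) (pow_nonneg h2 1),
    mul_nonneg (pow_nonneg h1 5) (pow_nonneg h2 0)]

theorem pv4_3 (T : ℝ) (h1 : 0 ≤ T - 24) :
    ((18.7781 + 27.5673 / 4) * (T ^ 2 - 7.0604 * T - 10.1186) + 5.0593 * (21.3270 + 33.3542 / 4) * T) * (T + 17.9) ≤ 2 * 5.0593 * (T ^ 2 - 7.0604 * T - 10.1186) * (4.368 * (T + 17.9) + 2 * (T - 17.9)) := by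
  linarith [pow_nonneg h1 1,
    pow_nonneg h1 2,
    pow_nonneg h1 3]

theorem pb4_3 (T : ℝ) (h1 : 0 ≤ T - 24) :
    4^2 * (((18.7781 + 27.5673 / 4) * (T + 17.9) - 5.0593 * (4.368 * (T + 17.9) + 2 * (T - 17.9))) * ((4.368 * (T + 17.9) + 2 * (T - 17.9)) * (T ^ 2 - 7.0604 * T - 10.1186) - (21.3270 + 33.3542 / 4) * (T + 17.9) * T)) ≤ 3.1517 * T ^ 3 * (T + 17.9) ^ 2 := by
  linarith [pow_nonneg h1 1,
    pow_nonneg h1 2,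
    pow_nonneg h1 3,
    pow_nonneg h1 4,
    pow_nonneg h1 5]

theorem pm5_0 (T : ℝ) (h1 : 0 ≤ T - 13.5) (h2 : 0 ≤ 16.8 - T) :
    5^2 * ((18.7781 + 27.5673 / 5) * (T ^ 2 - 7.0604 * T - 10.1186) - 5.0593 * (21.3270 + 33.3542 / 5) * T) ^ 2 ≤ 4 * 5.0593 * 3.1517 * (T ^ 2 - 7.0604 * T - 10.1186) * T ^ 3 := by
  linarith [mul_nonneg (pow_nonneg h1 0) (pow_nonneg h2 5),
    mul_nonneg (pow_nonneg h1 1) (pow_nonneg h2 4),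
    mul_nonneg (pow_nonneg h1 2) (pow_nonneg h2 3),
    mul_nonneg (pow_nonneg h1 3) (pow_nonneg h2 2),
    mul_nonneg (pow_nonneg h1 4) (pow_nonneg h2 1),
    mul_nonneg (pow_nonneg h1 5) (pow_nonneg h2 0)]

theorem pv5_0 (T : ℝ) (h1 : 0 ≤ T - 16.8) (h2 : 0 ≤ 19 - T) :
    ((18.7781 + 27.5673 / 5) * (T ^ 2 - 7.0604 * T - 10.1186) + 5.0593 * (21.3270 + 33.3542 / 5) * T) * (T + 16.8) ≤ 2 * 5.0593 * (T ^ 2 - 7.0604 * T - 10.1186) * (4.28 * (T + 16.8) + 2 * (T - 16.8)) := by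
  linarith [mul_nonneg (pow_nonneg h1 0) (pow_nonneg h2 3),
    mul_nonneg (pow_nonneg h1 1) (pow_nonneg h2 2),
    mul_nonneg (pow_nonneg h1 2) (pow_nonneg h2 1),
    mul_nonneg (pow_nonneg h1 3) (pow_nonneg h2 0)]

theorem pb5_0 (T : ℝ) (h1 : 0 ≤ T - 16.8) (h2 : 0 ≤ 19 - T) :
    5^2 * (((18.7781 + 27.5673 / 5) * (T + 16.8) - 5.0593 * (4.28 * (T + 16.8) + 2 * (T - 16.8))) * ((4.28 * (T + 16.8) + 2 * (T - 16.8)) * (T ^ 2 - 7.0604 * T - 10.1186) - (21.3270 + 33.3542 / 5) * (T + 16.8) * T)) ≤ 3.1517 * T ^ 3 * (T + 16.8) ^ 2 := by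
  linarith [mul_nonneg (pow_nonneg h1 0) (pow_nonneg h2 5),
    mul_nonneg (pow_nonneg h1 1) (pow_nonneg h2 4),
    mul_nonneg (pow_nonneg h1 2) (pow_nonneg h2 3),
    mul_nonneg (pow_nonneg h1 3) (pow_nonneg h2 2),
    mul_nonneg (pow_nonneg h1 4) (pow_nonneg h2 1),
    mul_nonneg (pow_nonneg h1 5) (pow_nonneg h2 0)]

theorem pv5_1 (T : ℝ) (h1 : 0 ≤ T - 19) :
    ((18.7781 + 27.5673 / 5) * (T ^ 2 - 7.0604 * T - 10.1186) + 5.0593 * (21.3270 + 33.3542 / 5) * T) * (T + 16.8) ≤ 2 * 5.0593 * (T ^ 2 - 7.0604 * T - 10.1186) * (4.28 * (T + 16.8) + 2 * (T - 16.8)) := by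
  linarith [pow_nonneg h1 1,
    pow_nonneg h1 2,
    pow_nonneg h1 3]

theorem pb5_1 (T : ℝ) (h1 : 0 ≤ T - 19) :
    5^2 * (((18.7781 + 27.5673 / 5) * (T + 16.8) - 5.0593 * (4.28 * (T + 16.8) + 2 * (T - 16.8))) * ((4.28 * (T + 16.8) + 2 * (T - 16.8)) * (T ^ 2 - 7.0604 * T - 10.1186) - (21.3270 + 33.3542 / 5) * (T + 16.8) * T)) ≤ 3.1517 * T ^ 3 * (T + 16.8) ^ 2 := by
  linarith [pow_nonneg h1 1,
    pow_nonneg h1 2,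
    pow_nonneg h1 3,
    pow_nonneg h1 4,
    pow_nonneg h1 5]

theorem pm6_0 (T : ℝ) (h1 : 0 ≤ T - 13.5) (h2 : 0 ≤ 15.1 - T) :
    6^2 * ((18.7781 + 27.5673 / 6) * (T ^ 2 - 7.0604 * T - 10.1186) - 5.0593 * (21.3270 + 33.3542 / 6) * T) ^ 2 ≤ 4 * 5.0593 * 3.1517 * (T ^ 2 - 7.0604 * T - 10.1186) * T ^ 3 := by
  linarith [mul_nonneg (pow_nonneg h1 0) (pow_nonneg h2 5),
    mul_nonneg (pow_nonneg h1 1) (pow_nonneg h2 4),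
    mul_nonneg (pow_nonneg h1 2) (pow_nonneg h2 3),
    mul_nonneg (pow_nonneg h1 3) (pow_nonneg h2 2),
    mul_nonneg (pow_nonneg h1 4) (pow_nonneg h2 1),
    mul_nonneg (pow_nonneg h1 5) (pow_nonneg h2 0)]

theorem pv6_0 (T : ℝ) (h1 : 0 ≤ T - 15.1) (h2 : 0 ≤ 17 - T) :
    ((18.7781 + 27.5673 / 6) * (T ^ 2 - 7.0604 * T - 10.1186) + 5.0593 * (21.3270 + 33.3542 / 6) * T) * (T + 13.5) ≤ 2 * 5.0593 * (T ^ 2 - 7.0604 * T - 10.1186) * (4.146 * (T + 13.5) + 2 * (T - 13.5)) := by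
  linarith [mul_nonneg (pow_nonneg h1 0) (pow_nonneg h2 3),
    mul_nonneg (pow_nonneg h1 1) (pow_nonneg h2 2),
    mul_nonneg (pow_nonneg h1 2) (pow_nonneg h2 1),
    mul_nonneg (pow_nonneg h1 3) (pow_nonneg h2 0)]

theorem pb6_0 (T : ℝ) (h1 : 0 ≤ T - 15.1) (h2 : 0 ≤ 17 - T) :
    6^2 * (((18.7781 + 27.5673 / 6) * (T + 13.5) - 5.0593 * (4.146 * (T + 13.5) + 2 * (T - 13.5))) * ((4.146 * (T + 13.5) + 2 * (T - 13.5)) * (T ^ 2 - 7.0604 * T - 10.1186) - (21.3270 + 33.3542 / 6) * (T + 13.5) * T)) ≤ 3.1517 * T ^ 3 * (T + 13.5) ^ 2 := by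
  linarith [mul_nonneg (pow_nonneg h1 0) (pow_nonneg h2 5),
    mul_nonneg (pow_nonneg h1 1) (pow_nonneg h2 4),
    mul_nonneg (pow_nonneg h1 2) (pow_nonneg h2 3),
    mul_nonneg (pow_nonneg h1 3) (pow_nonneg h2 2),
    mul_nonneg (pow_nonneg h1 4) (pow_nonneg h2 1),
    mul_nonneg (pow_nonneg h1 5) (pow_nonneg h2 0)]

theorem pv6_1 (T : ℝ) (h1 : 0 ≤ T - 17) :
    ((18.7781 + 27.5673 / 6) * (T ^ 2 - 7.0604 * T - 10.1186) + 5.0593 * (21.3270 + 33.3542 / 6) * T) * (T + 13.5) ≤ 2 * 5.0593 * (T ^ 2 - 7.0604 * T - 10.1186) * (4.146 * (T + 13.5) + 2 * (T - 13.5)) := by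
  linarith [pow_nonneg h1 1,
    pow_nonneg h1 2,
    pow_nonneg h1 3]

theorem pb6_1 (T : ℝ) (h1 : 0 ≤ T - 17) :
    6^2 * (((18.7781 + 27.5673 / 6) * (T + 13.5) - 5.0593 * (4.146 * (T + 13.5) + 2 * (T - 13.5))) * ((4.146 * (T + 13.5) + 2 * (T - 13.5)) * (T ^ 2 - 7.0604 * T - 10.1186) - (21.3270 + 33.3542 / 6) * (T + 13.5) * T)) ≤ 3.1517 * T ^ 3 * (T + 13.5) ^ 2 := by
  linarith [pow_nonneg h1 1,
    pow_nonneg h1 2,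
    pow_nonneg h1 3,
    pow_nonneg h1 4,
    pow_nonneg h1 5]

theorem pm7_0 (T : ℝ) (h1 : 0 ≤ T - 13.5) (h2 : 0 ≤ 15.1 - T) :
    7^2 * ((18.7781 + 27.5673 / 7) * (T ^ 2 - 7.0604 * T - 10.1186) - 5.0593 * (21.3270 + 33.3542 / 7) * T) ^ 2 ≤ 4 * 5.0593 * 3.1517 * (T ^ 2 - 7.0604 * T - 10.1186) * T ^ 3 := by
  linarith [mul_nonneg (pow_nonneg h1 0) (pow_nonneg h2 5),
    mul_nonneg (pow_nonneg h1 1) (pow_nonneg h2 4),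
    mul_nonneg (pow_nonneg h1 2) (pow_nonneg h2 3),
    mul_nonneg (pow_nonneg h1 3) (pow_nonneg h2 2),
    mul_nonneg (pow_nonneg h1 4) (pow_nonneg h2 1),
    mul_nonneg (pow_nonneg h1 5) (pow_nonneg h2 0)]

theorem pv7_0 (T : ℝ) (h1 : 0 ≤ T - 15.1) (h2 : 0 ≤ 17 - T) :
    ((18.7781 + 27.5673 / 7) * (T ^ 2 - 7.0604 * T - 10.1186) + 5.0593 * (21.3270 + 33.3542 / 7) * T) * (T + 13.5) ≤ 2 * 5.0593 * (T ^ 2 - 7.0604 * T - 10.1186) * (4.207 * (T + 13.5) + 2 * (T - 13.5)) := by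
  linarith [mul_nonneg (pow_nonneg h1 0) (pow_nonneg h2 3),
    mul_nonneg (pow_nonneg h1 1) (pow_nonneg h2 2),
    mul_nonneg (pow_nonneg h1 2) (pow_nonneg h2 1),
    mul_nonneg (pow_nonneg h1 3) (pow_nonneg h2 0)]

theorem pb7_0 (T : ℝ) (h1 : 0 ≤ T - 15.1) (h2 : 0 ≤ 17 - T) :
    7^2 * (((18.7781 + 27.5673 / 7) * (T + 13.5) - 5.0593 * (4.207 * (T + 13.5) + 2 * (T - 13.5))) * ((4.207 * (T + 13.5) + 2 * (T - 13.5)) * (T ^ 2 - 7.0604 * T - 10.1186) - (21.3270 + 33.3542 / 7) * (T + 13.5) * T)) ≤ 3.1517 * T ^ 3 * (T + 13.5) ^ 2 := by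
  linarith [mul_nonneg (pow_nonneg h1 0) (pow_nonneg h2 5),
    mul_nonneg (pow_nonneg h1 1) (pow_nonneg h2 4),
    mul_nonneg (pow_nonneg h1 2) (pow_nonneg h2 3),
    mul_nonneg (pow_nonneg h1 3) (pow_nonneg h2 2),
    mul_nonneg (pow_nonneg h1 4) (pow_nonneg h2 1),
    mul_nonneg (pow_nonneg h1 5) (pow_nonneg h2 0)]

theorem pv7_1 (T : ℝ) (h1 : 0 ≤ T - 17) :
    ((18.7781 + 27.5673 / 7) * (T ^ 2 - 7.0604 * T - 10.1186) + 5.0593 * (21.3270 + 33.3542 / 7) * T) * (T + 13.5) ≤ 2 * 5.0593 * (T ^ 2 - 7.0604 * T - 10.1186) * (4.207 * (T + 13.5) + 2 * (T - 13.5)) := by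
  linarith [pow_nonneg h1 1,
    pow_nonneg h1 2,
    pow_nonneg h1 3]

theorem pb7_1 (T : ℝ) (h1 : 0 ≤ T - 17) :
    7^2 * (((18.7781 + 27.5673 / 7) * (T + 13.5) - 5.0593 * (4.207 * (T + 13.5) + 2 * (T - 13.5))) * ((4.207 * (T + 13.5) + 2 * (T - 13.5)) * (T ^ 2 - 7.0604 * T - 10.1186) - (21.3270 + 33.3542 / 7) * (T + 13.5) * T)) ≤ 3.1517 * T ^ 3 * (T + 13.5) ^ 2 := by
  linarith [pow_nonneg h1 1,
    pow_nonneg h1 2,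
    pow_nonneg h1 3,
    pow_nonneg h1 4,
    pow_nonneg h1 5]

theorem pm8_0 (T : ℝ) (h1 : 0 ≤ T - 13.5) (h2 : 0 ≤ 15.1 - T) :
    8^2 * ((18.7781 + 27.5673 / 8) * (T ^ 2 - 7.0604 * T - 10.1186) - 5.0593 * (21.3270 + 33.3542 / 8) * T) ^ 2 ≤ 4 * 5.0593 * 3.1517 * (T ^ 2 - 7.0604 * T - 10.1186) * T ^ 3 := by
  linarith [mul_nonneg (pow_nonneg h1 0) (pow_nonneg h2 5),
    mul_nonneg (pow_nonneg h1 1) (pow_nonneg h2 4),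
    mul_nonneg (pow_nonneg h1 2) (pow_nonneg h2 3),
    mul_nonneg (pow_nonneg h1 3) (pow_nonneg h2 2),
    mul_nonneg (pow_nonneg h1 4) (pow_nonneg h2 1),
    mul_nonneg (pow_nonneg h1 5) (pow_nonneg h2 0)]

theorem pv8_0 (T : ℝ) (h1 : 0 ≤ T - 15.1) (h2 : 0 ≤ 17 - T) :
    ((18.7781 + 27.5673 / 8) * (T ^ 2 - 7.0604 * T - 10.1186) + 5.0593 * (21.3270 + 33.3542 / 8) * T) * (T + 13.5) ≤ 2 * 5.0593 * (T ^ 2 - 7.0604 * T - 10.1186) * (4.253 * (T + 13.5) + 2 * (T - 13.5)) := by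
  linarith [mul_nonneg (pow_nonneg h1 0) (pow_nonneg h2 3),
    mul_nonneg (pow_nonneg h1 1) (pow_nonneg h2 2),
    mul_nonneg (pow_nonneg h1 2) (pow_nonneg h2 1),
    mul_nonneg (pow_nonneg h1 3) (pow_nonneg h2 0)]

theorem pb8_0 (T : ℝ) (h1 : 0 ≤ T - 15.1) (h2 : 0 ≤ 17 - T) :
    8^2 * (((18.7781 + 27.5673 / 8) * (T + 13.5) - 5.0593 * (4.253 * (T + 13.5) + 2 * (T - 13.5))) * ((4.253 * (T + 13.5) + 2 * (T - 13.5)) * (T ^ 2 - 7.0604 * T - 10.1186) - (21.3270 + 33.3542 / 8) * (T + 13.5) * T)) ≤ 3.1517 * T ^ 3 * (T + 13.5) ^ 2 := by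
  linarith [mul_nonneg (pow_nonneg h1 0) (pow_nonneg h2 5),
    mul_nonneg (pow_nonneg h1 1) (pow_nonneg h2 4),
    mul_nonneg (pow_nonneg h1 2) (pow_nonneg h2 3),
    mul_nonneg (pow_nonneg h1 3) (pow_nonneg h2 2),
    mul_nonneg (pow_nonneg h1 4) (pow_nonneg h2 1),
    mul_nonneg (pow_nonneg h1 5) (pow_nonneg h2 0)]

theorem pv8_1 (T : ℝ) (h1 : 0 ≤ T - 17) :
    ((18.7781 + 27.5673 / 8) * (T ^ 2 - 7.0604 * T - 10.1186) + 5.0593 * (21.3270 + 33.3542 / 8) * T) * (T + 13.5) ≤ 2 * 5.0593 * (T ^ 2 - 7.0604 * T - 10.1186) * (4.253 * (T + 13.5) + 2 * (T - 13.5)) := by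
  linarith [pow_nonneg h1 1,
    pow_nonneg h1 2,
    pow_nonneg h1 3]

theorem pb8_1 (T : ℝ) (h1 : 0 ≤ T - 17) :
    8^2 * (((18.7781 + 27.5673 / 8) * (T + 13.5) - 5.0593 * (4.253 * (T + 13.5) + 2 * (T - 13.5))) * ((4.253 * (T + 13.5) + 2 * (T - 13.5)) * (T ^ 2 - 7.0604 * T - 10.1186) - (21.3270 + 33.3542 / 8) * (T + 13.5) * T)) ≤ 3.1517 * T ^ 3 * (T + 13.5) ^ 2 := by
  linarith [pow_nonneg h1 1,
    pow_nonneg h1 2,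
    pow_nonneg h1 3,
    pow_nonneg h1 4,
    pow_nonneg h1 5]

theorem pm9_0 (T : ℝ) (h1 : 0 ≤ T - 13.5) (h2 : 0 ≤ 15.1 - T) :
    9^2 * ((18.7781 + 27.5673 / 9) * (T ^ 2 - 7.0604 * T - 10.1186) - 5.0593 * (21.3270 + 33.3542 / 9) * T) ^ 2 ≤ 4 * 5.0593 * 3.1517 * (T ^ 2 - 7.0604 * T - 10.1186) * T ^ 3 := by
  linarith [mul_nonneg (pow_nonneg h1 0) (pow_nonneg h2 5),
    mul_nonneg (pow_nonneg h1 1) (pow_nonneg h2 4),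
    mul_nonneg (pow_nonneg h1 2) (pow_nonneg h2 3),
    mul_nonneg (pow_nonneg h1 3) (pow_nonneg h2 2),
    mul_nonneg (pow_nonneg h1 4) (pow_nonneg h2 1),
    mul_nonneg (pow_nonneg h1 5) (pow_nonneg h2 0)]

theorem pv9_0 (T : ℝ) (h1 : 0 ≤ T - 15.1) (h2 : 0 ≤ 17 - T) :
    ((18.7781 + 27.5673 / 9) * (T ^ 2 - 7.0604 * T - 10.1186) + 5.0593 * (21.3270 + 33.3542 / 9) * T) * (T + 13.5) ≤ 2 * 5.0593 * (T ^ 2 - 7.0604 * T - 10.1186) * (4.289 * (T + 13.5) + 2 * (T - 13.5)) := by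
  linarith [mul_nonneg (pow_nonneg h1 0) (pow_nonneg h2 3),
    mul_nonneg (pow_nonneg h1 1) (pow_nonneg h2 2),
    mul_nonneg (pow_nonneg h1 2) (pow_nonneg h2 1),
    mul_nonneg (pow_nonneg h1 3) (pow_nonneg h2 0)]

theorem pb9_0 (T : ℝ) (h1 : 0 ≤ T - 15.1) (h2 : 0 ≤ 17 - T) :
    9^2 * (((18.7781 + 27.5673 / 9) * (T + 13.5) - 5.0593 * (4.289 * (T + 13.5) + 2 * (T - 13.5))) * ((4.289 * (T + 13.5) + 2 * (T - 13.5)) * (T ^ 2 - 7.0604 * T - 10.1186) - (21.3270 + 33.3542 / 9) * (T + 13.5) * T)) ≤ 3.1517 * T ^ 3 * (T + 13.5) ^ 2 := by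
  linarith [mul_nonneg (pow_nonneg h1 0) (pow_nonneg h2 5),
    mul_nonneg (pow_nonneg h1 1) (pow_nonneg h2 4),
    mul_nonneg (pow_nonneg h1 2) (pow_nonneg h2 3),
    mul_nonneg (pow_nonneg h1 3) (pow_nonneg h2 2),
    mul_nonneg (pow_nonneg h1 4) (pow_nonneg h2 1),
    mul_nonneg (pow_nonneg h1 5) (pow_nonneg h2 0)]

theorem pv9_1 (T : ℝ) (h1 : 0 ≤ T - 17) :
    ((18.7781 + 27.5673 / 9) * (T ^ 2 - 7.0604 * T - 10.1186) + 5.0593 * (21.3270 + 33.3542 / 9) * T) * (T + 13.5) ≤ 2 * 5.0593 * (T ^ 2 - 7.0604 * T - 10.1186) * (4.289 * (T + 13.5) + 2 * (T - 13.5)) := by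
  linarith [pow_nonneg h1 1,
    pow_nonneg h1 2,
    pow_nonneg h1 3]

theorem pb9_1 (T : ℝ) (h1 : 0 ≤ T - 17) :
    9^2 * (((18.7781 + 27.5673 / 9) * (T + 13.5) - 5.0593 * (4.289 * (T + 13.5) + 2 * (T - 13.5))) * ((4.289 * (T + 13.5) + 2 * (T - 13.5)) * (T ^ 2 - 7.0604 * T - 10.1186) - (21.3270 + 33.3542 / 9) * (T + 13.5) * T)) ≤ 3.1517 * T ^ 3 * (T + 13.5) ^ 2 := by
  linarith [pow_nonneg h1 1,
    pow_nonneg h1 2,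
    pow_nonneg h1 3,
    pow_nonneg h1 4,
    pow_nonneg h1 5]

theorem T_large (n T w F : ℝ) (hn : 1 ≤ n) (hT : 0 < T)
    (hFe : F = T ^ 2 - 7.0604 * T - 10.1186) (hF : 0 < F)
    (h1 : 0 < 18.7781 + 27.5673 / n - 5.0593 * w)
    (h2 : 0 < w * F - (21.3270 + 33.3542 / n) * T) : 13.5 ≤ T := by
  by_contra hc
  push Not at hc
  have hi : 0 < 1 / n := by positivity
  rw [div_eq_mul_one_div (27.5673 : ℝ)] at h1
  rw [div_eq_mul_one_div (33.3542 : ℝ)] at h2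
  set i := 1 / n
  have h3 : F ≤ 5.6901 * T := by
    have : 0 ≤ (13.5 - T) * (T + 10.1186 / 13.5) := by
      apply mul_nonneg <;> linarith
    rw [hFe]; nlinarith
  have h4 : 0 < (18.7781 + 27.5673 * i - 5.0593 * w) * F := mul_pos h1 hF
  have h5 : 5.0593 * (21.3270 + 33.3542 * i) * T < (18.7781 + 27.5673 * i) * F := by nlinarith
  have h6 : (18.7781 + 27.5673 * i) * F ≤ (18.7781 + 27.5673 * i) * (5.6901 * T) := by gcongr
  have h7 : 0 < i * T := by positivity
  nlinarith

theorem w_right (T Ts w o r : ℝ) (hTs : 0 < Ts) (hT : Ts ≤ T)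
    (hw : Real.log (T / (2 * Real.pi)) + r ≤ w)
    (ho : o ≤ Real.log (Ts / (2 * Real.pi)) + r) :
    o * (T + Ts) + 2 * (T - Ts) ≤ w * (T + Ts) := by
  have h0 : 0 < T := by linarith
  have h := log_right T Ts hTs hT
  have h1 : Real.log (T / (2 * Real.pi)) = Real.log (Ts / (2 * Real.pi)) + Real.log (T / Ts) := by
    rw [← Real.log_mul (by positivity) (by positivity)]
    congr 1; field_simp
  have h2 : (o + Real.log (T / Ts)) * (T + Ts) ≤ w * (T + Ts) := by
    apply mul_le_mul_of_nonneg_right _ (by linarith)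
    linarith
  linarith

theorem w_left (T Ts w o r : ℝ) (h0 : 0 < T) (hT : T ≤ Ts)
    (hw : Real.log (T / (2 * Real.pi)) + r ≤ w)
    (ho : o ≤ Real.log (Ts / (2 * Real.pi)) + r) :
    o * (2 * T * Ts) + (T ^ 2 - Ts ^ 2) ≤ w * (2 * T * Ts) := by
  have hTs : 0 < Ts := by linarith
  have h := log_left T Ts h0 hT
  have h1 : Real.log (T / (2 * Real.pi)) = Real.log (Ts / (2 * Real.pi)) + Real.log (T / Ts) := by
    rw [← Real.log_mul (by positivity) (by positivity)]
    congr 1; field_simp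
  have h2 : (o + Real.log (T / Ts)) * (2 * T * Ts) ≤ w * (2 * T * Ts) := by
    apply mul_le_mul_of_nonneg_right _ (by positivity)
    linarith
  linarith

theorem log22 : 6.894699 ≤ Real.log (23 * (22 / (2 * Real.pi)) ^ 3) := by
  have hpi := Real.pi_lt_d6
  have hp := Real.pi_pos
  have h := log_lower 7 (-0.105301) (1 + 0.105301 + 0.105301 ^ 2 / 2)
    (23 * (22 / (2 * Real.pi)) ^ 3) (by positivity)
    (by rw [neg_neg]; exact Real.quadratic_le_exp_of_nonneg (by norm_num))
    (by
      have : (22 / (2 * 3.141593) : ℝ) ≤ 22 / (2 * Real.pi) := by gcongr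
      have h3 : (22 / (2 * 3.141593) : ℝ) ^ 3 ≤ (22 / (2 * Real.pi)) ^ 3 := by gcongr
      refine le_trans ?_ (mul_le_mul_of_nonneg_right (mul_le_mul_of_nonneg_left h3 (by norm_num)) (by norm_num))
      norm_num)
  norm_num at h ⊢
  linarith

theorem log179 : 17.055464 / 2 ≤ Real.log (77 * (17.9 / (2 * Real.pi)) ^ 4) := by
  have hpi := Real.pi_lt_d6
  have hp := Real.pi_pos
  have h := log_lower 17 (0.055464) (1 - 0.055464)
    ((77 * (17.9 / (2 * Real.pi)) ^ 4) ^ 2) (by positivity)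
    (by have := Real.add_one_le_exp (-0.055464); linarith)
    (by
      have : (17.9 / (2 * 3.141593) : ℝ) ≤ 17.9 / (2 * Real.pi) := by gcongr
      have h3 : (77 * (17.9 / (2 * 3.141593) : ℝ) ^ 4) ^ 2 ≤ (77 * (17.9 / (2 * Real.pi)) ^ 4) ^ 2 := by gcongr
      refine le_trans ?_ (mul_le_mul_of_nonneg_right h3 (by norm_num))
      norm_num)
  rw [Real.log_pow] at h
  push_cast at h
  linarith

theorem log168 : 0.981933 ≤ Real.log (16.8 / (2 * Real.pi)) := by
  have hpi := Real.pi_lt_d6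
  have hp := Real.pi_pos
  have h := log_lower 1 (-0.018067) (1 + 0.018067 + 0.018067 ^ 2 / 2)
    (16.8 / (2 * Real.pi)) (by positivity)
    (by rw [neg_neg]; exact Real.quadratic_le_exp_of_nonneg (by norm_num))
    (by
      have : (16.8 / (2 * 3.141593) : ℝ) ≤ 16.8 / (2 * Real.pi) := by gcongr
      refine le_trans ?_ (mul_le_mul_of_nonneg_right this (by norm_num))
      norm_num)
  push_cast at h
  linarith

theorem log135 : 0.764 ≤ Real.log (13.5 / (2 * Real.pi)) := by
  have hpi := Real.pi_lt_d6
  have hp := Real.pi_pos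
  have h := log_lower 3 (0.056) (1 - 0.056)
    ((13.5 / (2 * Real.pi)) ^ 4) (by positivity)
    (by have := Real.add_one_le_exp (-0.056); linarith)
    (by
      have : (13.5 / (2 * 3.141593) : ℝ) ≤ 13.5 / (2 * Real.pi) := by gcongr
      have h3 : (13.5 / (2 * 3.141593) : ℝ) ^ 4 ≤ (13.5 / (2 * Real.pi)) ^ 4 := by gcongr
      refine le_trans ?_ (mul_le_mul_of_nonneg_right h3 (by norm_num))
      norm_num)
  rw [Real.log_pow] at h
  push_cast at h
  linarith

theorem log_four_pi : Real.log (4 / Real.pi) ≤ 0.244 := by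
  have hp := Real.pi_gt_d6
  have h0 := Real.pi_pos
  rw [Real.log_le_iff_le_exp (by positivity)]
  refine le_trans ?_ (Real.quadratic_le_exp_of_nonneg (by norm_num : (0:ℝ) ≤ 0.244))
  rw [div_le_iff₀ h0]
  nlinarith

def gmk (n : ℕ) : ℝ :=
  2 * n * Real.log n - n * Real.log (4 / Real.pi) - 2 * Real.log (n.factorial)

theorem gmk_five : 5.31 ≤ gmk 5 := by
  have hp := Real.pi_gt_d6
  have h0 := Real.pi_pos
  have h := log_lower 16 (-0.07) (1 + 0.07 + 0.07 ^ 2 / 2)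
    (((3125 / 120) ^ 2 * (Real.pi / 4) ^ 5) ^ 3) (by positivity)
    (by rw [neg_neg]; exact Real.quadratic_le_exp_of_nonneg (by norm_num))
    (by
      have h3 : ((3125 / 120) ^ 2 * (3.141592 / 4 : ℝ) ^ 5) ^ 3 ≤ ((3125 / 120) ^ 2 * (Real.pi / 4) ^ 5) ^ 3 := by gcongr
      refine le_trans ?_ (mul_le_mul_of_nonneg_right h3 (by norm_num))
      norm_num)
  rw [Real.log_pow, Real.log_mul (by positivity) (by positivity), Real.log_pow, Real.log_pow,
    Real.log_div (by norm_num) (by norm_num), show (3125 : ℝ) = 5 ^ 5 by norm_num, Real.log_pow,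
    ← inv_div, Real.log_inv] at h
  unfold gmk
  rw [show Nat.factorial 5 = 120 by rfl]
  push_cast at h ⊢
  linarith

theorem gmk_succ (n : ℕ) (hn : 5 ≤ n) : gmk n + 1.574 ≤ gmk (n + 1) := by
  have hn' : (5 : ℝ) ≤ n := by exact_mod_cast hn
  have hn0 : (0 : ℝ) < n := by linarith
  have h := Real.le_log_one_add_of_nonneg (x := 1 / (n : ℝ)) (by positivity)
  have h1 : 2 * (1 / (n : ℝ)) / (1 / n + 2) = 2 / (2 * n + 1) := by field_simp; ring
  have h2 : Real.log (1 + 1 / (n : ℝ)) = Real.log (n + 1) - Real.log n := by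
    rw [← Real.log_div (by positivity) (by positivity)]; congr 1; field_simp
  rw [h1, h2] at h
  have h3 : 20 / 11 ≤ 2 * (n : ℝ) * (2 / (2 * n + 1)) := by
    rw [mul_div_assoc', div_le_div_iff₀ (by norm_num) (by positivity)]; linarith
  have h4 : 2 * (n : ℝ) * (2 / (2 * n + 1)) ≤ 2 * n * (Real.log (n + 1) - Real.log n) := by gcongr
  have h5 := log_four_pi
  unfold gmk
  rw [Nat.factorial_succ]
  push_cast
  rw [Real.log_mul (by positivity) (by positivity)]
  linarith

theorem gmk_lower (n : ℕ) (hn : 5 ≤ n) : 5.31 + 1.574 * ((n : ℝ) - 5) ≤ gmk n := by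
  induction n, hn using Nat.le_induction with
  | base => have := gmk_five; push_cast; linarith
  | succ m hm ih => have := gmk_succ m hm; push_cast; linarith

open NumberField in
theorem mink (K : Type*) [Field K] [NumberField K] :
    gmk (Module.finrank ℚ K) ≤ Real.log |(discr K : ℝ)| := by
  have h := abs_discr_ge' K
  rw [Int.cast_abs] at h
  have hn : 0 < Module.finrank ℚ K := Module.finrank_pos
  have hr := NumberField.InfinitePlace.card_add_two_mul_card_eq_rank K
  set n := Module.finrank ℚ K
  have hn' : (0 : ℝ) < n := by exact_mod_cast hn
  have h1 : (1 : ℝ) ≤ 4 / Real.pi := by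
    rw [le_div_iff₀ Real.pi_pos]; linarith [Real.pi_le_four]
  have hD : 0 < |(discr K : ℝ)| := by
    rw [abs_pos]; exact_mod_cast discr_ne_zero K
  have h2 : (n : ℝ) ^ (2 * n) / ((4 / Real.pi) ^ n * (n.factorial : ℝ) ^ 2) ≤ |(discr K : ℝ)| := by
    refine le_trans ?_ h
    gcongr
    omega
  have h3 := Real.log_le_log (by positivity) h2
  rw [Real.log_div (by positivity) (by positivity), Real.log_mul (by positivity) (by positivity),
    Real.log_pow, Real.log_pow, Real.log_pow] at h3
  unfold gmk
  push_cast at h3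
  linarith

theorem key3 (T w r : ℝ) (hT : 13.5 ≤ T) (hF : 0 < T ^ 2 - 7.0604 * T - 10.1186)
    (hw : Real.log (T / (2 * Real.pi)) + r ≤ w)
    (ho : 4.5343 ≤ Real.log (22 / (2 * Real.pi)) + r) :
    3 ^ 2 * (((18.7781 + 27.5673 / 3) - 5.0593 * w) * (w * (T ^ 2 - 7.0604 * T - 10.1186) - (21.3270 + 33.3542 / 3) * T)) ≤ 3.1517 * T ^ 3 := by
  rcases le_total T 20.3 with h | h
  · exact fin_max _ _ _ _ _ _ _ (by norm_num) hF (pm3_0 T (by linarith) (by linarith))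
  rcases le_total T 22 with h0 | h0
  · exact fin_W _ _ _ _ _ _ _ _ _ (by norm_num) hF (by linarith) (w_left T 22 w _ r (by linarith) (by linarith) hw ho)
      (pv3_0 T (by linarith) (by linarith)) (pb3_0 T (by linarith) (by linarith))
  rcases le_total T 23.4 with h1 | h1
  · exact fin_W _ _ _ _ _ _ _ _ _ (by norm_num) hF (by linarith) (w_right T 22 w _ r (by norm_num) (by linarith) hw ho)
      (pv3_1 T (by linarith) (by linarith)) (pb3_1 T (by linarith) (by linarith))
  rcases le_total T 24 with h2 | h2
  · exact fin_W _ _ _ _ _ _ _ _ _ (by norm_num) hF (by linarith) (w_right T 22 w _ r (by norm_num) (by linarith) hw ho)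
      (pv3_2 T (by linarith) (by linarith)) (pb3_2 T (by linarith) (by linarith))
  rcases le_total T 27 with h3 | h3
  · exact fin_W _ _ _ _ _ _ _ _ _ (by norm_num) hF (by linarith) (w_right T 22 w _ r (by norm_num) (by linarith) hw ho)
      (pv3_3 T (by linarith) (by linarith)) (pb3_3 T (by linarith) (by linarith))
  exact fin_W _ _ _ _ _ _ _ _ _ (by norm_num) hF (by linarith) (w_right T 22 w _ r (by norm_num) (by linarith) hw ho)
      (pv3_4 T (by linarith)) (pb3_4 T (by linarith))

theorem key4 (T w r : ℝ) (hT : 13.5 ≤ T) (hF : 0 < T ^ 2 - 7.0604 * T - 10.1186)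
    (hw : Real.log (T / (2 * Real.pi)) + r ≤ w)
    (ho : 4.368 ≤ Real.log (17.9 / (2 * Real.pi)) + r) :
    4 ^ 2 * (((18.7781 + 27.5673 / 4) - 5.0593 * w) * (w * (T ^ 2 - 7.0604 * T - 10.1186) - (21.3270 + 33.3542 / 4) * T)) ≤ 3.1517 * T ^ 3 := by
  rcases le_total T 17.9 with h | h
  · exact fin_max _ _ _ _ _ _ _ (by norm_num) hF (pm4_0 T (by linarith) (by linarith))
  rcases le_total T 20 with h0 | h0
  · exact fin_W _ _ _ _ _ _ _ _ _ (by norm_num) hF (by linarith) (w_right T 17.9 w _ r (by norm_num) (by linarith) hw ho)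
      (pv4_0 T (by linarith) (by linarith)) (pb4_0 T (by linarith) (by linarith))
  rcases le_total T 21 with h1 | h1
  · exact fin_W _ _ _ _ _ _ _ _ _ (by norm_num) hF (by linarith) (w_right T 17.9 w _ r (by norm_num) (by linarith) hw ho)
      (pv4_1 T (by linarith) (by linarith)) (pb4_1 T (by linarith) (by linarith))
  rcases le_total T 24 with h2 | h2
  · exact fin_W _ _ _ _ _ _ _ _ _ (by norm_num) hF (by linarith) (w_right T 17.9 w _ r (by norm_num) (by linarith) hw ho)
      (pv4_2 T (by linarith) (by linarith)) (pb4_2 T (by linarith) (by linarith))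
  exact fin_W _ _ _ _ _ _ _ _ _ (by norm_num) hF (by linarith) (w_right T 17.9 w _ r (by norm_num) (by linarith) hw ho)
      (pv4_3 T (by linarith)) (pb4_3 T (by linarith))

theorem key5 (T w r : ℝ) (hT : 13.5 ≤ T) (hF : 0 < T ^ 2 - 7.0604 * T - 10.1186)
    (hw : Real.log (T / (2 * Real.pi)) + r ≤ w)
    (ho : 4.28 ≤ Real.log (16.8 / (2 * Real.pi)) + r) :
    5 ^ 2 * (((18.7781 + 27.5673 / 5) - 5.0593 * w) * (w * (T ^ 2 - 7.0604 * T - 10.1186) - (21.3270 + 33.3542 / 5) * T)) ≤ 3.1517 * T ^ 3 := by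
  rcases le_total T 16.8 with h | h
  · exact fin_max _ _ _ _ _ _ _ (by norm_num) hF (pm5_0 T (by linarith) (by linarith))
  rcases le_total T 19 with h0 | h0
  · exact fin_W _ _ _ _ _ _ _ _ _ (by norm_num) hF (by linarith) (w_right T 16.8 w _ r (by norm_num) (by linarith) hw ho)
      (pv5_0 T (by linarith) (by linarith)) (pb5_0 T (by linarith) (by linarith))
  exact fin_W _ _ _ _ _ _ _ _ _ (by norm_num) hF (by linarith) (w_right T 16.8 w _ r (by norm_num) (by linarith) hw ho)
      (pv5_1 T (by linarith)) (pb5_1 T (by linarith))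

theorem key6 (T w r : ℝ) (hT : 13.5 ≤ T) (hF : 0 < T ^ 2 - 7.0604 * T - 10.1186)
    (hw : Real.log (T / (2 * Real.pi)) + r ≤ w)
    (ho : 4.146 ≤ Real.log (13.5 / (2 * Real.pi)) + r) :
    6 ^ 2 * (((18.7781 + 27.5673 / 6) - 5.0593 * w) * (w * (T ^ 2 - 7.0604 * T - 10.1186) - (21.3270 + 33.3542 / 6) * T)) ≤ 3.1517 * T ^ 3 := by
  rcases le_total T 15.1 with h | h
  · exact fin_max _ _ _ _ _ _ _ (by norm_num) hF (pm6_0 T (by linarith) (by linarith))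
  rcases le_total T 17 with h0 | h0
  · exact fin_W _ _ _ _ _ _ _ _ _ (by norm_num) hF (by linarith) (w_right T 13.5 w _ r (by norm_num) (by linarith) hw ho)
      (pv6_0 T (by linarith) (by linarith)) (pb6_0 T (by linarith) (by linarith))
  exact fin_W _ _ _ _ _ _ _ _ _ (by norm_num) hF (by linarith) (w_right T 13.5 w _ r (by norm_num) (by linarith) hw ho)
      (pv6_1 T (by linarith)) (pb6_1 T (by linarith))

theorem key7 (T w r : ℝ) (hT : 13.5 ≤ T) (hF : 0 < T ^ 2 - 7.0604 * T - 10.1186)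
    (hw : Real.log (T / (2 * Real.pi)) + r ≤ w)
    (ho : 4.207 ≤ Real.log (13.5 / (2 * Real.pi)) + r) :
    7 ^ 2 * (((18.7781 + 27.5673 / 7) - 5.0593 * w) * (w * (T ^ 2 - 7.0604 * T - 10.1186) - (21.3270 + 33.3542 / 7) * T)) ≤ 3.1517 * T ^ 3 := by
  rcases le_total T 15.1 with h | h
  · exact fin_max _ _ _ _ _ _ _ (by norm_num) hF (pm7_0 T (by linarith) (by linarith))
  rcases le_total T 17 with h0 | h0
  · exact fin_W _ _ _ _ _ _ _ _ _ (by norm_num) hF (by linarith) (w_right T 13.5 w _ r (by norm_num) (by linarith) hw ho)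
      (pv7_0 T (by linarith) (by linarith)) (pb7_0 T (by linarith) (by linarith))
  exact fin_W _ _ _ _ _ _ _ _ _ (by norm_num) hF (by linarith) (w_right T 13.5 w _ r (by norm_num) (by linarith) hw ho)
      (pv7_1 T (by linarith)) (pb7_1 T (by linarith))

theorem key8 (T w r : ℝ) (hT : 13.5 ≤ T) (hF : 0 < T ^ 2 - 7.0604 * T - 10.1186)
    (hw : Real.log (T / (2 * Real.pi)) + r ≤ w)
    (ho : 4.253 ≤ Real.log (13.5 / (2 * Real.pi)) + r) :
    8 ^ 2 * (((18.7781 + 27.5673 / 8) - 5.0593 * w) * (w * (T ^ 2 - 7.0604 * T - 10.1186) - (21.3270 + 33.3542 / 8) * T)) ≤ 3.1517 * T ^ 3 := by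
  rcases le_total T 15.1 with h | h
  · exact fin_max _ _ _ _ _ _ _ (by norm_num) hF (pm8_0 T (by linarith) (by linarith))
  rcases le_total T 17 with h0 | h0
  · exact fin_W _ _ _ _ _ _ _ _ _ (by norm_num) hF (by linarith) (w_right T 13.5 w _ r (by norm_num) (by linarith) hw ho)
      (pv8_0 T (by linarith) (by linarith)) (pb8_0 T (by linarith) (by linarith))
  exact fin_W _ _ _ _ _ _ _ _ _ (by norm_num) hF (by linarith) (w_right T 13.5 w _ r (by norm_num) (by linarith) hw ho)
      (pv8_1 T (by linarith)) (pb8_1 T (by linarith))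

theorem key9 (T w r : ℝ) (hT : 13.5 ≤ T) (hF : 0 < T ^ 2 - 7.0604 * T - 10.1186)
    (hw : Real.log (T / (2 * Real.pi)) + r ≤ w)
    (ho : 4.289 ≤ Real.log (13.5 / (2 * Real.pi)) + r) :
    9 ^ 2 * (((18.7781 + 27.5673 / 9) - 5.0593 * w) * (w * (T ^ 2 - 7.0604 * T - 10.1186) - (21.3270 + 33.3542 / 9) * T)) ≤ 3.1517 * T ^ 3 := by
  rcases le_total T 15.1 with h | h
  · exact fin_max _ _ _ _ _ _ _ (by norm_num) hF (pm9_0 T (by linarith) (by linarith))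
  rcases le_total T 17 with h0 | h0
  · exact fin_W _ _ _ _ _ _ _ _ _ (by norm_num) hF (by linarith) (w_right T 13.5 w _ r (by norm_num) (by linarith) hw ho)
      (pv9_0 T (by linarith) (by linarith)) (pb9_0 T (by linarith) (by linarith))
  exact fin_W _ _ _ _ _ _ _ _ _ (by norm_num) hF (by linarith) (w_right T 13.5 w _ r (by norm_num) (by linarith) hw ho)
      (pv9_1 T (by linarith)) (pb9_1 T (by linarith))

theorem key_all (K : Type*) [Field K] [NumberField K] (n : ℕ) (hn : Module.finrank ℚ K = n)
    (T w : ℝ) (hT : 0 < T) (hF : 0 < T ^ 2 - 7.0604 * T - 10.1186)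
    (hw : Real.log (T / (2 * Real.pi)) + (2.236067 + Real.log |(discr K : ℝ)| / n) ≤ w)
    (h1 : 0 < 18.7781 + 27.5673 / (n : ℝ) - 5.0593 * w)
    (h2 : 0 < w * (T ^ 2 - 7.0604 * T - 10.1186) - (21.3270 + 33.3542 / (n : ℝ)) * T) :
    (n : ℝ) ^ 2 * ((18.7781 + 27.5673 / (n : ℝ) - 5.0593 * w) *
      (w * (T ^ 2 - 7.0604 * T - 10.1186) - (21.3270 + 33.3542 / (n : ℝ)) * T))
      ≤ 3.1517 * T ^ 3 := by
  have hn0 : 1 ≤ n := by rw [← hn]; exact Module.finrank_pos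
  have hT1 := T_large n T w _ (by exact_mod_cast hn0) hT rfl hF h1 h2
  have l135 := log135
  have hM := mink K
  rw [hn] at hM
  rcases le_or_gt 10 n with hc | hc
  · exfalso
    have hg := gmk_lower n (by omega)
    have hn' : (10 : ℝ) ≤ n := by exact_mod_cast hc
    have h3 : 1.318 ≤ Real.log |(discr K : ℝ)| / n := by
      rw [le_div_iff₀ (by linarith)]; linarith
    have h4 : Real.log (13.5 / (2 * Real.pi)) ≤ Real.log (T / (2 * Real.pi)) := by
      apply Real.log_le_log (by positivity); gcongr
    have h5 : 27.5673 / (n : ℝ) ≤ 2.75673 := by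
      rw [div_le_iff₀ (by linarith)]; linarith
    linarith
  · interval_cases n
    · have := fin_max _ _ _ _ _ w _ (by norm_num) hF (pm1_0 T (by linarith))
      push_cast; exact this
    · rcases le_total T 28 with h | h
      · have := fin_max _ _ _ _ _ w _ (by norm_num) hF (pm2_0 T (by linarith) (by linarith))
        push_cast; exact this
      rcases le_total T 40 with h' | h'
      · have := fin_max _ _ _ _ _ w _ (by norm_num) hF (pm2_1 T (by linarith) (by linarith))
        push_cast; exact this
      · have := fin_max _ _ _ _ _ w _ (by norm_num) hF (pm2_2 T (by linarith))
        push_cast; exact this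
    · have hD : (23 : ℝ) ≤ |(discr K : ℝ)| := by exact_mod_cast cubic_bound hn
      have hl := Real.log_le_log (by norm_num) hD
      have hg := log22
      rw [Real.log_mul (by norm_num) (by positivity), Real.log_pow] at hg
      push_cast at hg hw ⊢
      exact key3 T w _ hT1 hF hw (by linarith)
    · have hD : (77 : ℝ) ≤ |(discr K : ℝ)| := by exact_mod_cast quartic_bound hn
      have hl := Real.log_le_log (by norm_num) hD
      have hg := log179
      rw [Real.log_mul (by norm_num) (by positivity), Real.log_pow] at hg
      push_cast at hg hw ⊢
      exact key4 T w _ hT1 hF hw (by linarith)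
    · have hg := gmk_lower 5 (by norm_num)
      have hg2 := log168
      push_cast at hg hw ⊢
      exact key5 T w _ hT1 hF hw (by linarith)
    · have hg := gmk_lower 6 (by norm_num)
      push_cast at hg hw ⊢
      exact key6 T w _ hT1 hF hw (by linarith)
    · have hg := gmk_lower 7 (by norm_num)
      push_cast at hg hw ⊢
      exact key7 T w _ hT1 hF hw (by linarith)
    · have hg := gmk_lower 8 (by norm_num)
      push_cast at hg hw ⊢
      exact key8 T w _ hT1 hF hw (by linarith)
    · have hg := gmk_lower 9 (by norm_num)
      push_cast at hg hw ⊢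
      exact key9 T w _ hT1 hF hw (by linarith)

theorem const_bound : 3.1517 ≤ 0.5167 * Real.pi * ((Real.sqrt 5 - 1) * Real.pi / 2) := by
  have hp := Real.pi_gt_d6
  have h5 := sqrt5_lower
  have h1 : (3.141592 : ℝ) * 3.141592 ≤ Real.pi * Real.pi := by gcongr
  have h2 : (1.236067 : ℝ) * (3.141592 * 3.141592) ≤ (Real.sqrt 5 - 1) * (Real.pi * Real.pi) := by
    apply mul_le_mul (by linarith) h1 (by positivity) (by linarith)
  linarith

/-- Lemma 3.1: the bound
`(18.7781 + 27.5673/n_K − 5.0593 w)/T₀² ≤ 0.5167 π/(n_K √x)`. -/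
theorem statement_9
    (K : Type*) [Field K] [NumberField K]
    (x : ℝ) (hx : 3 ≤ x)
    (TF : ℝ) (hTF0 : 0 < TF) (hTF : TF ^ 2 - 7.0604 * TF - 10.1186 = 0)
    (L S T0 w : ℝ)
    (hL : L = Real.sqrt 5 + Real.log (deltaK K))
    (hS : S = (Real.sqrt 5 - 1) * Real.pi * Real.sqrt x / (2 * nK K)
            + 21.3270 + 33.3542 / nK K)
    (hT0 : TF < T0)
    (hT0eq : (T0 - 7.0604 - 10.1186 / T0) * (Real.log (T0 / (2 * Real.pi)) + L) = S)
    (hw : w = Real.log (T0 / (2 * Real.pi)) + L) :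
    (18.7781 + 27.5673 / nK K - 5.0593 * w) / T0 ^ 2
      ≤ 0.5167 * Real.pi / (nK K * Real.sqrt x) := by
  have hp := Real.pi_pos
  have hn0 : 0 < Module.finrank ℚ K := Module.finrank_pos
  have hnK : (0 : ℝ) < nK K := by unfold nK; exact_mod_cast hn0
  have hsx : 0 < Real.sqrt x := Real.sqrt_pos.mpr (by linarith)
  have hT : 0 < T0 := hTF0.trans hT0
  have hF : 0 < T0 ^ 2 - 7.0604 * T0 - 10.1186 := by
    have h0 : 0 < TF + T0 - 7.0604 := by
      by_contra hc
      push Not at hc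
      nlinarith
    have := mul_pos (sub_pos.mpr hT0) h0
    nlinarith
  have hR : 0 < 0.5167 * Real.pi / (nK K * Real.sqrt x) := by positivity
  rcases le_or_gt (18.7781 + 27.5673 / nK K - 5.0593 * w) 0 with h1 | h1
  · exact (div_nonpos_of_nonpos_of_nonneg h1 (by positivity)).trans hR.le
  rw [← hw] at hT0eq
  have hpT : w * (T0 ^ 2 - 7.0604 * T0 - 10.1186) - (21.3270 + 33.3542 / nK K) * T0
      = (Real.sqrt 5 - 1) * Real.pi * Real.sqrt x / (2 * nK K) * T0 := by
    have h3 : T0 ^ 2 - 7.0604 * T0 - 10.1186 = (T0 - 7.0604 - 10.1186 / T0) * T0 := by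
      field_simp
    rw [h3]
    linear_combination T0 * hT0eq + T0 * hS
  have h5 := sqrt5_lower
  have hs5 : 0 < Real.sqrt 5 - 1 := by linarith
  have h2 : 0 < w * (T0 ^ 2 - 7.0604 * T0 - 10.1186) - (21.3270 + 33.3542 / nK K) * T0 := by
    rw [hpT]; positivity
  have hD : 0 < |(NumberField.discr K : ℝ)| := by
    rw [abs_pos]; exact_mod_cast NumberField.discr_ne_zero K
  have hlog : Real.log (deltaK K) = Real.log |(NumberField.discr K : ℝ)| / nK K := by
    unfold deltaK DeltaK
    rw [Real.log_rpow hD]; ring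
  have hw' : Real.log (T0 / (2 * Real.pi)) + (2.236067 + Real.log |(NumberField.discr K : ℝ)| / nK K)
      ≤ w := by
    rw [hw, hL, hlog]; linarith
  have key := key_all K _ rfl T0 w hT hF hw' h1 h2
  change nK K ^ 2 * ((18.7781 + 27.5673 / nK K - 5.0593 * w) *
      (w * (T0 ^ 2 - 7.0604 * T0 - 10.1186) - (21.3270 + 33.3542 / nK K) * T0))
      ≤ 3.1517 * T0 ^ 3 at key
  rw [hpT] at key
  set D := 18.7781 + 27.5673 / nK K - 5.0593 * w
  have hc := const_bound
  have key2 : nK K ^ 2 * (D * ((Real.sqrt 5 - 1) * Real.pi * Real.sqrt x / (2 * nK K) * T0))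
      = (((Real.sqrt 5 - 1) * Real.pi / 2) * T0) * (D * (nK K * Real.sqrt x)) := by
    field_simp
  have key3 : (((Real.sqrt 5 - 1) * Real.pi / 2) * T0) * (D * (nK K * Real.sqrt x))
      ≤ (((Real.sqrt 5 - 1) * Real.pi / 2) * T0) * (0.5167 * Real.pi * T0 ^ 2) := by
    rw [← key2]
    refine key.trans ?_
    have := mul_le_mul_of_nonneg_right hc (by positivity : 0 ≤ T0 ^ 3)
    linarith
  have key4 := le_of_mul_le_mul_left key3 (by positivity)
  rw [div_le_div_iff₀ (by positivity) (by positivity)]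
  exact key4
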